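/- arXiv:1310.2380 — 9 statements merged into one kernel-verified Lean document; each statement's English description precedes it below -/
import Mathlib

section
/- Let Z, X, Y be Banach spaces and let i: Z→X and f: Z→Y be nonexpansive linear operators. Then there exist a Banach space W and nonexpansive linear operators g: X→W and j: Y→W with g∘i = j∘f, such that for every Banach space W' and all nonexpansive linear operators g': X→W', j': Y→W' with g'∘i = j'∘f there exists a unique nonexpansive linear operator h: W→W' with h∘g = g' and h∘j = j' (i.e., the square is a pushout in the category of Banach spaces with nonexpansive linear operators). -/
/-- A bundled Banach space (over `ℝ`). -/
structure BanachSpace where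
  carrier : Type
  [instNormedAddCommGroup : NormedAddCommGroup carrier]
  [instNormedSpace : NormedSpace ℝ carrier]
  [instCompleteSpace : CompleteSpace carrier]

attribute [instance] BanachSpace.instNormedAddCommGroup BanachSpace.instNormedSpace
  BanachSpace.instCompleteSpace

/-- Pushouts exist in the category of Banach spaces with nonexpansive linear operators. -/
theorem pushout_exists_in_Ban
    {Z X Y : Type} [NormedAddCommGroup Z] [NormedSpace ℝ Z] [CompleteSpace Z]
    [NormedAddCommGroup X] [NormedSpace ℝ X] [CompleteSpace X]
    [NormedAddCommGroup Y] [NormedSpace ℝ Y] [CompleteSpace Y]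
    (i : Z →L[ℝ] X) (f : Z →L[ℝ] Y) (hi : ‖i‖ ≤ 1) (hf : ‖f‖ ≤ 1) :
    ∃ (W : BanachSpace) (g : X →L[ℝ] W.carrier) (j : Y →L[ℝ] W.carrier),
      ‖g‖ ≤ 1 ∧ ‖j‖ ≤ 1 ∧ g.comp i = j.comp f ∧
      ∀ (W' : BanachSpace) (g' : X →L[ℝ] W'.carrier) (j' : Y →L[ℝ] W'.carrier),
        ‖g'‖ ≤ 1 → ‖j'‖ ≤ 1 → g'.comp i = j'.comp f →
        ∃! h : W.carrier →L[ℝ] W'.carrier,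
          ‖h‖ ≤ 1 ∧ h.comp g = g' ∧ h.comp j = j' := by
  classical
  let E := WithLp 1 (X × Y)
  let inX : X →ₗ[ℝ] E :=
    (WithLp.linearEquiv 1 ℝ (X × Y)).symm.toLinearMap ∘ₗ LinearMap.inl ℝ X Y
  let inY : Y →ₗ[ℝ] E :=
    (WithLp.linearEquiv 1 ℝ (X × Y)).symm.toLinearMap ∘ₗ LinearMap.inr ℝ X Y
  have hinX : ∀ x, ‖inX x‖ = ‖x‖ := fun x => by
    simp [inX, E, WithLp.prod_norm_eq_of_L1]
  have hinY : ∀ y, ‖inY y‖ = ‖y‖ := fun y => by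
    simp [inY, E, WithLp.prod_norm_eq_of_L1]
  have hdec : ∀ e : E, e = inX e.fst + inY e.snd := fun e => by
    apply (WithLp.linearEquiv 1 ℝ (X × Y)).injective
    refine Prod.ext ?_ ?_
    · change e.fst = e.fst + 0
      rw [add_zero]
    · change e.snd = 0 + e.snd
      rw [zero_add]
  let d : Z →ₗ[ℝ] E := inX ∘ₗ i.toLinearMap - inY ∘ₗ f.toLinearMap
  let S : Submodule ℝ E := (LinearMap.range d).topologicalClosure
  have hS : IsClosed (S : Set E) := Submodule.isClosed_topologicalClosure _
  let W : BanachSpace := { carrier := E ⧸ S }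
  let g : X →L[ℝ] (E ⧸ S) := (S.mkQ ∘ₗ inX).mkContinuous 1 (fun x => by
    rw [one_mul, ← hinX x]; exact Submodule.Quotient.norm_mk_le S (inX x))
  let j : Y →L[ℝ] (E ⧸ S) := (S.mkQ ∘ₗ inY).mkContinuous 1 (fun y => by
    rw [one_mul, ← hinY y]; exact Submodule.Quotient.norm_mk_le S (inY y))
  refine ⟨W, g, j, LinearMap.mkContinuous_norm_le _ zero_le_one _,
    LinearMap.mkContinuous_norm_le _ zero_le_one _, ?_, ?_⟩
  · ext z
    change (Submodule.Quotient.mk (inX (i z)) : E ⧸ S) = Submodule.Quotient.mk (inY (f z))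
    rw [Submodule.Quotient.eq]
    exact Submodule.le_topologicalClosure _ ⟨z, rfl⟩
  · intro W' g' j' hg hj hc
    let k : E →ₗ[ℝ] W'.carrier :=
      (g'.toLinearMap.coprod j'.toLinearMap) ∘ₗ (WithLp.linearEquiv 1 ℝ (X × Y)).toLinearMap
    have hk : ∀ e : E, k e = g' e.fst + j' e.snd := fun e => rfl
    have hkn : ∀ e : E, ‖k e‖ ≤ 1 * ‖e‖ := fun e => by
      rw [hk, one_mul, WithLp.prod_norm_eq_of_L1]
      refine (norm_add_le _ _).trans (add_le_add ?_ ?_)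
      · simpa using g'.le_of_opNorm_le hg e.fst
      · simpa using j'.le_of_opNorm_le hj e.snd
    let kc : E →L[ℝ] W'.carrier := k.mkContinuous 1 hkn
    have hkX : ∀ x, k (inX x) = g' x := fun x => by rw [hk]; simp [inX]
    have hkY : ∀ y, k (inY y) = j' y := fun y => by rw [hk]; simp [inY]
    have hker : S ≤ LinearMap.ker k := by
      refine Submodule.topologicalClosure_minimal _ ?_ (ContinuousLinearMap.isClosed_ker kc)
      rintro _ ⟨z, rfl⟩
      have := DFunLike.congr_fun hc z
      simp only [ContinuousLinearMap.comp_apply] at this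
      change k (inX (i z) - inY (f z)) = 0
      rw [map_sub, hkX, hkY, this, sub_self]
    have hb : ∀ w : E ⧸ S, ‖S.liftQ k hker w‖ ≤ 1 * ‖w‖ := fun w => by
      refine le_of_forall_pos_le_add fun ε hε => ?_
      obtain ⟨m, rfl, hm⟩ := Submodule.Quotient.norm_mk_lt w hε
      have h2 := hkn m
      change ‖k m‖ ≤ _
      linarith
    let h : (E ⧸ S) →L[ℝ] W'.carrier := (S.liftQ k hker).mkContinuous 1 hb
    refine ⟨h, ⟨LinearMap.mkContinuous_norm_le _ zero_le_one _, ?_, ?_⟩, ?_⟩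
    · ext x
      exact hkX x
    · ext y
      exact hkY y
    · rintro h' ⟨-, h1, h2⟩
      refine ContinuousLinearMap.ext fun w => ?_
      obtain ⟨e, rfl⟩ := Submodule.Quotient.mk_surjective S w
      have e1 : h' (Submodule.Quotient.mk (inX e.fst)) = g' e.fst := DFunLike.congr_fun h1 e.fst
      have e2 : h' (Submodule.Quotient.mk (inY e.snd)) = j' e.snd := DFunLike.congr_fun h2 e.snd
      change h' (Submodule.Quotient.mk e) = k e
      rw [hk, ← e1, ← e2]
      refine Eq.trans ?_ (map_add h' _ _)
      exact congrArg (fun t : E => h' (Submodule.Quotient.mk t)) (hdec e)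
end

section
/- Let Z, X, Y be Banach spaces, let i: Z→X be a linear isometric embedding and let f: Z→Y be a nonexpansive linear operator. Then there exist a Banach space W, a nonexpansive linear operator g: X→W and a linear isometric embedding j: Y→W such that g∘i = j∘f. -/
/-- If `i` is an isometric embedding and `f` a nonexpansive operator, there are a Banach space
`W`, a nonexpansive operator `g` and an isometric embedding `j` with `g ∘ i = j ∘ f`. -/
theorem pushout_isometric_leg
    {Z X Y : Type} [NormedAddCommGroup Z] [NormedSpace ℝ Z] [CompleteSpace Z]
    [NormedAddCommGroup X] [NormedSpace ℝ X] [CompleteSpace X]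
    [NormedAddCommGroup Y] [NormedSpace ℝ Y] [CompleteSpace Y]
    (i : Z →ₗᵢ[ℝ] X) (f : Z →L[ℝ] Y) (hf : ‖f‖ ≤ 1) :
    ∃ (W : BanachSpace) (g : X →L[ℝ] W.carrier) (j : Y →ₗᵢ[ℝ] W.carrier),
      ‖g‖ ≤ 1 ∧ ∀ z : Z, g (i z) = j (f z) := by
  let N : Z →L[ℝ] WithLp 1 (X × Y) :=
    (WithLp.prodContinuousLinearEquiv 1 ℝ X Y).symm.toContinuousLinearMap.comp
      (i.toContinuousLinearMap.prod (-f))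
  have hN : ∀ z, N z = WithLp.toLp 1 (i z, -f z) := fun z => rfl
  have hfz : ∀ z, ‖f z‖ ≤ ‖z‖ := fun z => by
    simpa using f.le_of_opNorm_le hf z
  have hanti : AntilipschitzWith 1 N := by
    refine N.antilipschitz_of_bound (fun z => ?_)
    change ‖z‖ ≤ _ * ‖N z‖
    rw [hN, WithLp.prod_norm_eq_of_L1]
    simp
  let S : Submodule ℝ (WithLp 1 (X × Y)) := N.toLinearMap.range
  have hS : IsClosed (S : Set (WithLp 1 (X × Y))) := by
    have h := hanti.isClosed_range N.uniformContinuous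
    simpa [S, LinearMap.coe_range] using h
  let q : WithLp 1 (X × Y) →ₗ[ℝ] (WithLp 1 (X × Y) ⧸ S) := S.mkQ
  have hq : ∀ m, ‖q m‖ ≤ ‖m‖ := fun m => Submodule.Quotient.norm_mk_le S m
  let e := (WithLp.linearEquiv 1 ℝ (X × Y)).symm.toLinearMap
  let g : X →ₗ[ℝ] (WithLp 1 (X × Y) ⧸ S) := q ∘ₗ e ∘ₗ LinearMap.inl ℝ X Y
  let j : Y →ₗ[ℝ] (WithLp 1 (X × Y) ⧸ S) := q ∘ₗ e ∘ₗ LinearMap.inr ℝ X Y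
  have hg : ∀ x, ‖g x‖ ≤ 1 * ‖x‖ := fun x => by
    refine (hq (WithLp.toLp 1 (x, 0))).trans ?_
    rw [WithLp.prod_norm_eq_of_L1]
    simp
  have hj : ∀ y, ‖j y‖ = ‖y‖ := fun y => by
    refine le_antisymm ?_ ?_
    · refine (hq (WithLp.toLp 1 (0, y))).trans ?_
      rw [WithLp.prod_norm_eq_of_L1]
      simp
    · refine QuotientAddGroup.le_norm_iff.2 (fun m hm => ?_)
      have hm' : q m = q (WithLp.toLp 1 (0, y)) := hm
      have hmem : m - WithLp.toLp 1 (0, y) ∈ S := (Submodule.Quotient.eq S).1 hm'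
      obtain ⟨z, hz⟩ := hmem
      have hz' : m = WithLp.toLp 1 (i z, y - f z) := by
        have h1 : WithLp.toLp 1 (i z, -f z) = m - WithLp.toLp 1 (0, y) := hz
        rw [eq_sub_iff_add_eq] at h1
        rw [← h1, ← WithLp.toLp_add]
        simp [sub_eq_neg_add]
      rw [hz', WithLp.prod_norm_eq_of_L1]
      change ‖y‖ ≤ ‖i z‖ + ‖y - f z‖
      have h2 := norm_add_le (f z) (y - f z)
      rw [add_sub_cancel] at h2
      rw [i.norm_map]
      linarith [hfz z]
  refine ⟨⟨WithLp 1 (X × Y) ⧸ S⟩, g.mkContinuous 1 hg, ⟨j, hj⟩,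
    g.mkContinuous_norm_le zero_le_one hg, fun z => ?_⟩
  change q (WithLp.toLp 1 (i z, 0)) = q (WithLp.toLp 1 (0, f z))
  refine (Submodule.Quotient.eq S).2 ⟨z, ?_⟩
  change WithLp.toLp 1 (i z, -f z) = _
  rw [← WithLp.toLp_sub]
  simp
end

section
/- Let ε>0 and let f: X→Y be a linear operator between Banach spaces satisfying (1−ε)‖x‖ ≤ ‖f(x)‖ ≤ (1+ε)‖x‖ for all x∈X. Then ‖·‖_C is a norm on X×Y, the canonical maps i_X: x↦(x,0) and j_Y: y↦(0,y) from X and Y into X⊕_{(f,ε)}Y are linear isometric embeddings, and ‖(w, −f(w))‖_C ≤ ε·‖w‖_X for every w∈X (that is, ‖i_X − j_Y∘f‖ ≤ ε). -/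
/-- The norm `‖·‖_C` on `X × Y` associated to a map `f : X → Y` and `ε > 0`:
`‖v‖_C = inf { ‖x‖ + ‖y‖ + ε‖w‖ : v = (x + w, y - f w) }`. -/
noncomputable def normC {X Y : Type*} [NormedAddCommGroup X] [NormedAddCommGroup Y]
    (ε : ℝ) (f : X → Y) (v : X × Y) : ℝ :=
  sInf {r : ℝ | ∃ (x w : X) (y : Y), v = (x + w, y - f w) ∧ r = ‖x‖ + ‖y‖ + ε * ‖w‖}

theorem normC_le_aux {X Y : Type*} [NormedAddCommGroup X] [NormedAddCommGroup Y]
    {ε : ℝ} (hε : 0 < ε) (f : X → Y) (v : X × Y) (x w : X) (y : Y)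
    (h : v = (x + w, y - f w)) : normC ε f v ≤ ‖x‖ + ‖y‖ + ε * ‖w‖ := by
  refine csInf_le ⟨0, ?_⟩ ⟨x, w, y, h, rfl⟩
  rintro r ⟨x, w, y, -, rfl⟩
  positivity

theorem le_normC_aux {X Y : Type*} [NormedAddCommGroup X] [NormedAddCommGroup Y]
    {ε : ℝ} (f : X → Y) (v : X × Y) (c : ℝ)
    (h : ∀ (x w : X) (y : Y), v = (x + w, y - f w) → c ≤ ‖x‖ + ‖y‖ + ε * ‖w‖) :
    c ≤ normC ε f v := by
  refine le_csInf ⟨_, v.1, 0, v.2 + f 0, by simp, rfl⟩ ?_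
  rintro r ⟨x, w, y, hv, rfl⟩
  exact h x w y hv

theorem normC_smul_le_aux {X Y : Type*} [NormedAddCommGroup X] [NormedSpace ℝ X]
    [NormedAddCommGroup Y] [NormedSpace ℝ Y]
    {ε : ℝ} (hε : 0 < ε) (f : X →ₗ[ℝ] Y) (a : ℝ) (ha : a ≠ 0) (v : X × Y) :
    normC ε f (a • v) ≤ |a| * normC ε f v := by
  have hpos : 0 < |a| := abs_pos.mpr ha
  rw [← div_le_iff₀' hpos]
  refine le_normC_aux _ _ _ fun x w y hv => ?_
  rw [div_le_iff₀' hpos]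
  have := normC_le_aux hε f (a • v) (a • x) (a • w) (a • y)
    (by rw [hv]; simp [smul_add, smul_sub])
  simp only [norm_smul, Real.norm_eq_abs] at this
  linarith

/-- `‖·‖_C` is a norm on `X × Y`, the canonical maps `x ↦ (x,0)` and `y ↦ (0,y)` are
isometric embeddings, and `‖(w, -f w)‖_C ≤ ε‖w‖` for every `w`. -/
theorem normC_is_norm_and_canonical_maps_isometric
    {X Y : Type*} [NormedAddCommGroup X] [NormedSpace ℝ X] [CompleteSpace X]
    [NormedAddCommGroup Y] [NormedSpace ℝ Y] [CompleteSpace Y]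
    (ε : ℝ) (hε : 0 < ε) (f : X →ₗ[ℝ] Y)
    (hf : ∀ x : X, (1 - ε) * ‖x‖ ≤ ‖f x‖ ∧ ‖f x‖ ≤ (1 + ε) * ‖x‖) :
    (∀ v : X × Y, 0 ≤ normC ε f v) ∧
    (∀ v : X × Y, normC ε f v = 0 ↔ v = 0) ∧
    (∀ (a : ℝ) (v : X × Y), normC ε f (a • v) = |a| * normC ε f v) ∧
    (∀ v w : X × Y, normC ε f (v + w) ≤ normC ε f v + normC ε f w) ∧
    (∀ x : X, normC ε f ((x, 0) : X × Y) = ‖x‖) ∧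
    (∀ y : Y, normC ε f ((0, y) : X × Y) = ‖y‖) ∧
    (∀ w : X, normC ε f ((w, -f w) : X × Y) ≤ ε * ‖w‖) := by
  have h0 : ∀ v : X × Y, 0 ≤ normC ε f v := fun v =>
    le_normC_aux _ _ _ fun x w y _ => by positivity
  have hX : ∀ x : X, normC ε f ((x, 0) : X × Y) = ‖x‖ := by
    intro x
    apply le_antisymm
    · simpa using normC_le_aux hε f (x, 0) x 0 0 (by simp)
    · refine le_normC_aux _ _ _ fun x' w y hv => ?_
      obtain ⟨h1, h2⟩ := Prod.mk.inj hv
      have hy : y = f w := (sub_eq_zero.mp h2.symm)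
      rw [h1, hy]
      have := (hf w).1
      have := norm_add_le x' w
      linarith
  have hY : ∀ y : Y, normC ε f ((0, y) : X × Y) = ‖y‖ := by
    intro y
    apply le_antisymm
    · simpa using normC_le_aux hε f (0, y) 0 0 y (by simp)
    · refine le_normC_aux _ _ _ fun x w y' hv => ?_
      obtain ⟨h1, h2⟩ := Prod.mk.inj hv
      have hx : x = -w := eq_neg_of_add_eq_zero_left h1.symm
      rw [h2, hx, norm_neg]
      have := (hf w).2
      have := norm_sub_le y' (f w)
      linarith
  refine ⟨h0, ?_, ?_, ?_, hX, hY, ?_⟩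
  · intro v
    constructor
    · intro hv
      have ha : ε * ‖v.1‖ / (1 + ε) ≤ normC ε f v := by
        refine le_normC_aux _ _ _ fun x w y h => ?_
        rw [div_le_iff₀ (by positivity), h]
        have h1 := mul_le_mul_of_nonneg_left (norm_add_le x w) hε.le
        have : 0 ≤ ‖x‖ + ‖y‖ + ε * ‖y‖ + ε * (ε * ‖w‖) := by positivity
        simp only
        linarith
      have hb : ε * ‖v.2‖ / (1 + ε) ≤ normC ε f v := by
        refine le_normC_aux _ _ _ fun x w y h => ?_
        rw [div_le_iff₀ (by positivity), h]
        have h1 := mul_le_mul_of_nonneg_left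
          ((norm_sub_le y (f w)).trans (add_le_add_right (hf w).2 _)) hε.le
        have : 0 ≤ ‖x‖ + ‖y‖ + ε * ‖x‖ := by positivity
        simp only
        linarith
      rw [hv, div_le_iff₀ (by positivity), zero_mul] at ha hb
      have ha' : ‖v.1‖ ≤ 0 := nonpos_of_mul_nonpos_right ha hε
      have hb' : ‖v.2‖ ≤ 0 := nonpos_of_mul_nonpos_right hb hε
      exact Prod.ext (norm_le_zero_iff.mp ha') (norm_le_zero_iff.mp hb')
    · rintro rfl
      exact (hX 0).trans norm_zero
  · intro a v
    by_cases ha : a = 0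
    · subst ha
      have := hX 0
      rw [zero_smul, abs_zero, zero_mul]
      exact this.trans norm_zero
    · apply le_antisymm (normC_smul_le_aux hε f a ha v)
      have h := normC_smul_le_aux hε f a⁻¹ (inv_ne_zero ha) (a • v)
      rw [inv_smul_smul₀ ha, abs_inv] at h
      rwa [← le_inv_mul_iff₀ (abs_pos.mpr ha)]
  · intro v v'
    rw [← sub_le_iff_le_add]
    refine le_normC_aux _ _ _ fun x w y h => ?_
    rw [sub_le_comm]
    refine le_normC_aux _ _ _ fun x' w' y' h' => ?_
    rw [sub_le_iff_le_add]
    have h3 := normC_le_aux hε f (v + v') (x + x') (w + w') (y + y') (by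
      rw [h, h', map_add, Prod.mk_add_mk]
      congr 1 <;> abel)
    have := norm_add_le x x'
    have := norm_add_le y y'
    have := mul_le_mul_of_nonneg_left (norm_add_le w w') hε.le
    linarith
  · intro w
    simpa using normC_le_aux hε f (w, -f w) 0 w 0 (by simp)
end

section
/- Let ε>0, let f: X→Y be a linear operator between Banach spaces satisfying (1−ε)‖x‖ ≤ ‖f(x)‖ ≤ (1+ε)‖x‖ for all x∈X, and let Z be a Banach space with nonexpansive linear operators i: X→Z and j: Y→Z such that ‖i(x) − j(f(x))‖ ≤ ε‖x‖ for all x∈X. Then the linear operator h: X⊕_{(f,ε)}Y → Z defined by h(x,y) = i(x) + j(y) satisfies ‖h(v)‖ ≤ ‖v‖_C for all v, and h is the unique linear operator with h∘i_X = i and h∘j_Y = j. (Thus (i_X, j_Y) is an initial object of the category of pairs of nonexpansive operators (i,j) with ‖i − j∘f‖ ≤ ε.) -/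
/-- Initiality of `(i_X, j_Y)`: given nonexpansive `i : X → Z`, `j : Y → Z` with
`‖i(x) - j(f(x))‖ ≤ ε‖x‖`, the map `h(x,y) = i(x)+j(y)` is nonexpansive from
`X ⊕_{(f,ε)} Y` to `Z` and is the unique linear operator with `h ∘ i_X = i`, `h ∘ j_Y = j`. -/
theorem normC_initial_object
    {X Y Z : Type*} [NormedAddCommGroup X] [NormedSpace ℝ X] [CompleteSpace X]
    [NormedAddCommGroup Y] [NormedSpace ℝ Y] [CompleteSpace Y]
    [NormedAddCommGroup Z] [NormedSpace ℝ Z] [CompleteSpace Z]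
    (ε : ℝ) (hε : 0 < ε) (f : X →ₗ[ℝ] Y)
    (hf : ∀ x : X, (1 - ε) * ‖x‖ ≤ ‖f x‖ ∧ ‖f x‖ ≤ (1 + ε) * ‖x‖)
    (i : X →L[ℝ] Z) (j : Y →L[ℝ] Z) (hi : ‖i‖ ≤ 1) (hj : ‖j‖ ≤ 1)
    (hij : ∀ x : X, ‖i x - j (f x)‖ ≤ ε * ‖x‖) :
    (∀ v : X × Y, ‖i v.1 + j v.2‖ ≤ normC ε f v) ∧
    (∀ h : X × Y →ₗ[ℝ] Z, (∀ x : X, h ((x, 0) : X × Y) = i x) →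
      (∀ y : Y, h ((0, y) : X × Y) = j y) →
      ∀ v : X × Y, h v = i v.1 + j v.2) := by
  refine ⟨fun v => ?_, fun h h1 h2 v => ?_⟩
  · unfold normC
    refine le_csInf ⟨_, v.1, 0, v.2, by simp, rfl⟩ ?_
    rintro r ⟨x, w, y, rfl, rfl⟩
    have e : i (x + w) + j (y - f w) = i x + j y + (i w - j (f w)) := by
      rw [map_add, map_sub]; abel
    have a : ‖i x‖ ≤ ‖x‖ := by simpa using i.le_of_opNorm_le hi x
    have b : ‖j y‖ ≤ ‖y‖ := by simpa using j.le_of_opNorm_le hj y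
    have c := hij w
    have d := norm_add₃_le (a := i x) (b := j y) (c := i w - j (f w))
    change ‖i (x + w) + j (y - f w)‖ ≤ _
    rw [e]
    linarith
  · rw [← h1, ← h2, ← map_add]
    simp
end

section
/- Let ε, δ > 0, let X₀, Y₀, X₁, Y₁ be Banach spaces, let T₀: X₀→X₁ and T₁: Y₀→Y₁ be nonexpansive linear operators, and let f₀: X₀→Y₀, f₁: X₁→Y₁ be ε-isometric embeddings such that ‖f₁∘T₀ − T₁∘f₀‖ ≤ δ. Then the linear operator T₀⊕T₁: (x,y) ↦ (T₀x, T₁y) from X₀ ⊕_{(f₀,ε+δ)} Y₀ to X₁ ⊕_{(f₁,ε)} Y₁ has norm ≤ 1, and it satisfies (T₀⊕T₁)∘i_{X₀} = i_{X₁}∘T₀ and (T₀⊕T₁)∘j_{Y₀} = j_{Y₁}∘T₁. -/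
/-- `f` is an `ε`-isometric embedding: `(1+ε)⁻¹‖x‖ ≤ ‖f x‖ ≤ ‖x‖`. -/
def IsEpsIsometry {X Y : Type*} [NormedAddCommGroup X] [NormedAddCommGroup Y]
    (ε : ℝ) (f : X → Y) : Prop :=
  ∀ x : X, (1 + ε)⁻¹ * ‖x‖ ≤ ‖f x‖ ∧ ‖f x‖ ≤ ‖x‖

/-- If the square `f₁ ∘ T₀ ≈ T₁ ∘ f₀` is `δ`-commutative and `f₀, f₁` are `ε`-embeddings,
then `T₀ ⊕ T₁ : X₀ ⊕_{(f₀,ε+δ)} Y₀ → X₁ ⊕_{(f₁,ε)} Y₁` is nonexpansive and commutes with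
the canonical embeddings. -/
theorem normC_sum_operator_nonexpansive
    {X₀ Y₀ X₁ Y₁ : Type*}
    [NormedAddCommGroup X₀] [NormedSpace ℝ X₀] [CompleteSpace X₀]
    [NormedAddCommGroup Y₀] [NormedSpace ℝ Y₀] [CompleteSpace Y₀]
    [NormedAddCommGroup X₁] [NormedSpace ℝ X₁] [CompleteSpace X₁]
    [NormedAddCommGroup Y₁] [NormedSpace ℝ Y₁] [CompleteSpace Y₁]
    (ε δ : ℝ) (hε : 0 < ε) (hδ : 0 < δ)
    (T₀ : X₀ →L[ℝ] X₁) (T₁ : Y₀ →L[ℝ] Y₁) (hT₀ : ‖T₀‖ ≤ 1) (hT₁ : ‖T₁‖ ≤ 1)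
    (f₀ : X₀ →L[ℝ] Y₀) (f₁ : X₁ →L[ℝ] Y₁)
    (hf₀ : IsEpsIsometry ε f₀) (hf₁ : IsEpsIsometry ε f₁)
    (hcomm : ‖f₁.comp T₀ - T₁.comp f₀‖ ≤ δ) :
    (∀ v : X₀ × Y₀, normC ε f₁ ((T₀ v.1, T₁ v.2) : X₁ × Y₁) ≤ normC (ε + δ) f₀ v) ∧
    (∀ x : X₀, (Prod.map T₀ T₁) ((x, 0) : X₀ × Y₀) = ((T₀ x, 0) : X₁ × Y₁)) ∧
    (∀ y : Y₀, (Prod.map T₀ T₁) ((0, y) : X₀ × Y₀) = ((0, T₁ y) : X₁ × Y₁)) := by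
  refine ⟨?_, by intro x; simp, by intro y; simp⟩
  intro v
  unfold normC
  refine le_csInf ⟨_, v.1, 0, v.2, by simp, rfl⟩ ?_
  rintro r ⟨x, w, y, rfl, rfl⟩
  have hbdd : BddBelow {r : ℝ | ∃ (x' w' : X₁) (y' : Y₁),
      ((T₀ (x + w), T₁ (y - f₀ w)) : X₁ × Y₁) = (x' + w', y' - f₁ w') ∧
        r = ‖x'‖ + ‖y'‖ + ε * ‖w'‖} := by
    refine ⟨0, ?_⟩
    rintro r ⟨x', w', y', -, rfl⟩
    positivity
  refine (csInf_le hbdd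
    ⟨T₀ x, T₀ w, T₁ y + (f₁.comp T₀ - T₁.comp f₀) w, ?_, rfl⟩).trans ?_
  · ext
    · simp
    · simp
      abel
  · have h1 : ‖T₀ x‖ ≤ 1 * ‖x‖ := T₀.le_of_opNorm_le hT₀ x
    have h2 : ‖T₀ w‖ ≤ 1 * ‖w‖ := T₀.le_of_opNorm_le hT₀ w
    have h3 : ‖T₁ y‖ ≤ 1 * ‖y‖ := T₁.le_of_opNorm_le hT₁ y
    have h4 := (f₁.comp T₀ - T₁.comp f₀).le_of_opNorm_le hcomm w
    have h5 := norm_add_le (T₁ y) ((f₁.comp T₀ - T₁.comp f₀) w)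
    have h6 := mul_le_mul_of_nonneg_left h2 hε.le
    linarith
end

section
/- Let ‖·‖ be a norm on ℝ^m and let X ⊆ ℝ^m be a linear subspace spanned by vectors of ℚ^m. Assume the restriction of ‖·‖ to X is rational, i.e., there exist finitely many linear functionals φ₁,…,φ_k on X mapping X∩ℚ^m into ℚ such that ‖x‖ = max_{i≤k} |φ_i(x)| for all x∈X. Then for every δ>0 there exists a rational norm ‖·‖' on ℝ^m such that (1+δ)^{-1}‖y‖ ≤ ‖y‖' ≤ (1+δ)‖y‖ for all y∈ℝ^m and ‖x‖' = ‖x‖ for all x∈X. -/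
/-- `N` is a norm on `ℝ^m`. -/
def IsNormOn (m : ℕ) (N : (Fin m → ℝ) → ℝ) : Prop :=
  (∀ v, 0 ≤ N v) ∧ (∀ v, N v = 0 ↔ v = 0) ∧
  (∀ (a : ℝ) (v), N (a • v) = |a| * N v) ∧ (∀ v w, N (v + w) ≤ N v + N w)

/-- A vector of `ℝ^m` with rational coordinates. -/
def IsRationalVec {m : ℕ} (v : Fin m → ℝ) : Prop := ∀ i, ∃ q : ℚ, v i = (q : ℝ)

/-- A rational norm on `ℝ^m`: a maximum of finitely many linear functionals mapping
`ℚ^m` into `ℚ`. -/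
def IsRationalNorm (m : ℕ) (N : (Fin m → ℝ) → ℝ) : Prop :=
  ∃ (k : ℕ) (φ : Fin k → ((Fin m → ℝ) →ₗ[ℝ] ℝ)),
    (∀ (i : Fin k) (v : Fin m → ℝ), IsRationalVec v → ∃ q : ℚ, φ i v = (q : ℝ)) ∧
    (∀ v, N v = ⨆ i, |φ i v|)

/-- functional mapping rational vectors to rationals -/
def RatFun {m : ℕ} (f : (Fin m → ℝ) →ₗ[ℝ] ℝ) : Prop :=
  ∀ v, IsRationalVec v → ∃ q : ℚ, f v = (q : ℝ)

theorem vec_eq_sum {m : ℕ} (v : Fin m → ℝ) :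
    v = ∑ i, v i • (Pi.single i (1:ℝ) : Fin m → ℝ) := by
  exact pi_eq_sum_univ' v

theorem norm_upper {m : ℕ} {N : (Fin m → ℝ) → ℝ} (hN : IsNormOn m N) :
    ∃ C : ℝ, 0 ≤ C ∧ ∀ v, N v ≤ C * ‖v‖ := by
  obtain ⟨h0, hz, hs, ht⟩ := hN
  refine ⟨∑ i, N (Pi.single i 1), Finset.sum_nonneg fun i _ => h0 _, fun v => ?_⟩
  have key : ∀ s : Finset (Fin m), N (∑ i ∈ s, v i • (Pi.single i (1:ℝ) : Fin m → ℝ)) ≤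
      ∑ i ∈ s, N (v i • (Pi.single i (1:ℝ) : Fin m → ℝ)) := by
    intro s
    exact Finset.le_sum_of_subadditive N ((hz 0).2 rfl).le ht s _
  conv_lhs => rw [vec_eq_sum v]
  refine (key _).trans ?_
  rw [Finset.sum_mul]
  refine Finset.sum_le_sum fun i _ => ?_
  rw [hs, mul_comm]
  exact mul_le_mul_of_nonneg_left (norm_le_pi_norm v i) (h0 _)

theorem norm_cont {m : ℕ} {N : (Fin m → ℝ) → ℝ} (hN : IsNormOn m N) : Continuous N := by
  obtain ⟨C, hC0, hC⟩ := norm_upper hN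
  obtain ⟨h0, hz, hs, ht⟩ := hN
  refine (LipschitzWith.of_le_add_mul (f := N) (⟨C, hC0⟩ : NNReal) fun x y => ?_).continuous
  have h1 := ht y (x - y)
  rw [add_sub_cancel] at h1
  have h2 := hC (x - y)
  rw [dist_eq_norm]
  exact h1.trans (add_le_add le_rfl h2)

theorem norm_lower {m : ℕ} {N : (Fin m → ℝ) → ℝ} (hN : IsNormOn m N) :
    ∃ c : ℝ, 0 < c ∧ ∀ v, ‖v‖ ≤ c * N v := by
  have hc := norm_cont hN
  obtain ⟨h0, hz, hs, ht⟩ := hN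
  have hne : ∀ v ∈ Metric.sphere (0 : Fin m → ℝ) 1, N v ≠ 0 := by
    intro v hv h
    rw [(hz v).1 h] at hv
    simp at hv
  obtain ⟨c, hcb⟩ := (isCompact_sphere (0 : Fin m → ℝ) 1).exists_bound_of_continuousOn
    (f := fun v => (N v)⁻¹) (hc.continuousOn.inv₀ hne)
  refine ⟨max c 1, by positivity, fun v => ?_⟩
  by_cases hv : v = 0
  · subst hv
    simp [(hz 0).2 rfl]
  have hvp : 0 < ‖v‖ := norm_pos_iff.2 hv
  have hm : ‖v‖⁻¹ • v ∈ Metric.sphere (0 : Fin m → ℝ) 1 := by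
    simp [norm_smul, hvp.ne']
  have hNp : 0 < N v := lt_of_le_of_ne (h0 v) fun h => hv ((hz v).1 h.symm)
  have h3 := hcb _ hm
  rw [hs, abs_of_pos (inv_pos.2 hvp), mul_inv, inv_inv, Real.norm_of_nonneg (by positivity)] at h3
  have h4 : ‖v‖ ≤ c * N v := by
    rwa [← div_eq_mul_inv, div_le_iff₀ hNp] at h3
  exact h4.trans (mul_le_mul_of_nonneg_right (le_max_left _ _) hNp.le)

theorem rat_approx {m : ℕ} (f : (Fin m → ℝ) →ₗ[ℝ] ℝ) (ε : ℝ) (hε : 0 < ε) :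
    ∃ g : (Fin m → ℝ) →ₗ[ℝ] ℝ, RatFun g ∧ ∀ v, |g v - f v| ≤ ε * ‖v‖ := by
  have hm : (0:ℝ) < m + 1 := by positivity
  have : ∀ i : Fin m, ∃ q : ℚ, |(q:ℝ) - f (Pi.single i 1)| < ε / (m + 1) := by
    intro i
    obtain ⟨q, hq⟩ := exists_rat_near (f (Pi.single i 1)) (div_pos hε hm)
    exact ⟨q, by rwa [abs_sub_comm]⟩
  choose q hq using this
  refine ⟨∑ i, (q i : ℝ) • LinearMap.proj i, ?_, ?_⟩
  · intro v hv
    choose w hw using hv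
    refine ⟨∑ i, q i * w i, ?_⟩
    simp [hw]
  · intro v
    have h1 : f v = ∑ i, v i * f (Pi.single i 1) := by
      conv_lhs => rw [vec_eq_sum v]
      simp only [map_sum, map_smul, smul_eq_mul]
    rw [h1]
    simp only [LinearMap.sum_apply, LinearMap.smul_apply, LinearMap.proj_apply, smul_eq_mul]
    rw [← Finset.sum_sub_distrib]
    refine (Finset.abs_sum_le_sum_abs _ _).trans ?_
    have h2 : ∀ i ∈ (Finset.univ : Finset (Fin m)),
        |(q i : ℝ) * v i - v i * f (Pi.single i 1)| ≤ ε / (m + 1) * ‖v‖ := by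
      intro i _
      rw [mul_comm (v i), ← sub_mul, abs_mul]
      exact mul_le_mul (hq i).le (norm_le_pi_norm v i) (abs_nonneg _) (by positivity)
    refine (Finset.sum_le_sum h2).trans ?_
    rw [Finset.sum_const, Finset.card_univ, Fintype.card_fin, nsmul_eq_mul, ← mul_assoc]
    refine mul_le_mul_of_nonneg_right ?_ (norm_nonneg _)
    rw [mul_div_assoc', div_le_iff₀ hm]
    nlinarith

/-- coordinatewise embedding of rational vectors -/
def ratEmb (m : ℕ) : (Fin m → ℚ) →ₗ[ℚ] (Fin m → ℝ) where
  toFun w := fun i => (w i : ℝ)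
  map_add' x y := by ext i; simp
  map_smul' a x := by ext i; simp [Rat.smul_def]

theorem exists_proj {m : ℕ} (X : Submodule ℝ (Fin m → ℝ))
    (hXrat : X = Submodule.span ℝ {v | v ∈ X ∧ IsRationalVec v}) :
    ∃ P : (Fin m → ℝ) →ₗ[ℝ] (Fin m → ℝ), (∀ v, P v ∈ X) ∧ (∀ x ∈ X, P x = x) ∧
      (∀ v, IsRationalVec v → IsRationalVec (P v)) := by
  let XQ : Submodule ℚ (Fin m → ℚ) := (X.restrictScalars ℚ).comap (ratEmb m)
  obtain ⟨p, hp⟩ := XQ.subtype.exists_leftInverse_of_injective (by simp)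
  let P : (Fin m → ℝ) →ₗ[ℝ] (Fin m → ℝ) :=
    ∑ i, (LinearMap.proj i : (Fin m → ℝ) →ₗ[ℝ] ℝ).smulRight
      (ratEmb m (p (Pi.single i 1)))
  have hP : ∀ v, P v = ∑ i, v i • ratEmb m (p (Pi.single i 1)) := by
    intro v; simp [P]
  have hPQ : ∀ w, P (ratEmb m w) = ratEmb m (p w) := by
    intro w
    rw [hP]
    conv_rhs => rw [pi_eq_sum_univ' w]
    simp only [map_sum, map_smul, Submodule.coe_sum, Submodule.coe_smul]
    refine Finset.sum_congr rfl fun i _ => ?_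
    ext j
    simp [ratEmb, Rat.smul_def]
  have hrat : ∀ v : Fin m → ℝ, IsRationalVec v → ∃ w, ratEmb m w = v := by
    intro v hv
    choose w hw using hv
    exact ⟨w, by ext i; simp [ratEmb, hw]⟩
  refine ⟨P, ?_, ?_, ?_⟩
  · intro v
    rw [hP]
    exact X.sum_mem fun i _ => X.smul_mem _ (p (Pi.single i 1)).2
  · intro x hx
    rw [hXrat] at hx
    induction hx using Submodule.span_induction with
    | mem x h =>
      obtain ⟨w, rfl⟩ := hrat x h.2
      rw [hPQ]
      have := LinearMap.congr_fun hp ⟨w, h.1⟩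
      simp only [LinearMap.comp_apply, Submodule.subtype_apply, LinearMap.id_apply] at this
      rw [this]
    | zero => simp
    | add x y _ _ h1 h2 => rw [map_add, h1, h2]
    | smul a x _ h => rw [map_smul, h]
  · intro v hv
    obtain ⟨w, rfl⟩ := hrat v hv
    rw [hPQ]
    intro i
    exact ⟨_, rfl⟩

theorem hahn_banach {m : ℕ} {N : (Fin m → ℝ) → ℝ} (hN : IsNormOn m N)
    (Y : Submodule ℝ (Fin m → ℝ)) (f : Y →ₗ[ℝ] ℝ) (hf : ∀ x : Y, f x ≤ N x) :
    ∃ g : (Fin m → ℝ) →ₗ[ℝ] ℝ, (∀ x : Y, g x = f x) ∧ ∀ v, |g v| ≤ N v := by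
  obtain ⟨h0, hz, hs, ht⟩ := hN
  obtain ⟨g, hg1, hg2⟩ := exists_extension_of_le_sublinear ⟨Y, f⟩ N
    (fun c hc x => by rw [hs, abs_of_pos hc]) ht hf
  refine ⟨g, hg1, fun v => abs_le'.2 ⟨hg2 v, ?_⟩⟩
  have := hg2 (-v)
  rw [map_neg] at this
  have h2 := hs (-1) v
  simp at h2
  rwa [h2] at this

theorem norming {m : ℕ} {N : (Fin m → ℝ) → ℝ} (hN : IsNormOn m N) (y : Fin m → ℝ) (hy : y ≠ 0) :
    ∃ g : (Fin m → ℝ) →ₗ[ℝ] ℝ, g y = N y ∧ ∀ v, |g v| ≤ N v := by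
  let e := LinearEquiv.toSpanNonzeroSingleton ℝ (Fin m → ℝ) y hy
  obtain ⟨g, h1, h2⟩ := hahn_banach hN (Submodule.span ℝ {y}) (N y • e.symm.toLinearMap) (by
    intro x
    obtain ⟨a, rfl⟩ := e.surjective x
    have : ((e a : Submodule.span ℝ {y}) : Fin m → ℝ) = a • y := by
      simp [e]
    rw [this, hN.2.2.1]
    simp only [LinearMap.smul_apply, LinearEquiv.coe_coe, LinearEquiv.symm_apply_apply, smul_eq_mul]
    rw [mul_comm]
    exact mul_le_mul_of_nonneg_right (le_abs_self a) (hN.1 y))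
  refine ⟨g, ?_, h2⟩
  have h3 := h1 (e 1)
  have : ((e 1 : Submodule.span ℝ {y}) : Fin m → ℝ) = y := by
    simp [e]
  rw [this] at h3
  rw [h3]
  simp

theorem rat_norming {m : ℕ} {N : (Fin m → ℝ) → ℝ} (hN : IsNormOn m N) (y : Fin m → ℝ)
    (hy : y ≠ 0) (r : ℝ) (hr0 : 0 < r) (hr : r < 1) :
    ∃ g : (Fin m → ℝ) →ₗ[ℝ] ℝ, RatFun g ∧ r * N y < |g y| ∧ ∀ v, |g v| ≤ N v := by
  obtain ⟨f, hf1, hf2⟩ := norming hN y hy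
  obtain ⟨c, hc0, hc⟩ := norm_lower hN
  obtain ⟨g, hg1, hg2⟩ := rat_approx (((1 + r) / 2) • f) ((1 - r) / 4 / c)
    (div_pos (by linarith) hc0)
  have hg3 : ∀ v, |g v - (1 + r) / 2 * f v| ≤ (1 - r) / 4 * N v := by
    intro v
    refine (hg2 v).trans ?_
    rw [div_mul_eq_mul_div, div_le_iff₀ hc0]
    have := mul_le_mul_of_nonneg_left (hc v) (show 0 ≤ (1 - r) / 4 by linarith)
    linarith
  have hNp : 0 < N y := lt_of_le_of_ne (hN.1 y) fun h => hy ((hN.2.1 y).1 h.symm)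
  refine ⟨g, hg1, ?_, fun v => ?_⟩
  · have h1 := (abs_le.1 (hg3 y)).1
    rw [hf1] at h1
    have h2 := le_abs_self (g y)
    nlinarith
  · have h1 := abs_le.1 (hg3 v)
    have h2 := abs_le.1 (hf2 v)
    have h3 := hN.1 v
    rw [abs_le]
    constructor <;> nlinarith

theorem rat_ext {m : ℕ} {N : (Fin m → ℝ) → ℝ} (hN : IsNormOn m N)
    (X : Submodule ℝ (Fin m → ℝ))
    (hXrat : X = Submodule.span ℝ {v | v ∈ X ∧ IsRationalVec v})
    (φ : ↥X →ₗ[ℝ] ℝ)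
    (hφrat : ∀ (x : ↥X), IsRationalVec (x : Fin m → ℝ) → ∃ q : ℚ, φ x = (q : ℝ))
    (hφ : ∀ x : X, φ x ≤ N x) (δ : ℝ) (hδ : 0 < δ) :
    ∃ g : (Fin m → ℝ) →ₗ[ℝ] ℝ, RatFun g ∧ (∀ x : X, g x = φ x) ∧
      ∀ v, |g v| ≤ (1 + δ) * N v := by
  obtain ⟨P, hP1, hP2, hP3⟩ := exists_proj X hXrat
  obtain ⟨F, hF1, hF2⟩ := hahn_banach hN X φ hφ
  obtain ⟨c, hc0, hc⟩ := norm_lower hN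
  let L : (Fin m → ℝ) →L[ℝ] (Fin m → ℝ) := LinearMap.toContinuousLinearMap (LinearMap.id - P)
  have hL : ∀ v, L v = v - P v := fun v => by simp [L]
  have hK : 0 < (‖L‖ + 1) * c := by positivity
  obtain ⟨g, hg1, hg2⟩ := rat_approx F (δ / ((‖L‖ + 1) * c)) (div_pos hδ hK)
  have hG : ∀ v, (φ ∘ₗ P.codRestrict X hP1 + g ∘ₗ (LinearMap.id - P) :
      (Fin m → ℝ) →ₗ[ℝ] ℝ) v =
      φ ⟨P v, hP1 v⟩ + (g v - g (P v)) := by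
    intro v
    simp
    rfl
  refine ⟨φ ∘ₗ P.codRestrict X hP1 + g ∘ₗ (LinearMap.id - P), ?_, ?_, ?_⟩
  · intro v hv
    rw [hG]
    obtain ⟨a, ha⟩ := hφrat ⟨P v, hP1 v⟩ (hP3 v hv)
    obtain ⟨b, hb⟩ := hg1 v hv
    obtain ⟨d, hd⟩ := hg1 (P v) (hP3 v hv)
    exact ⟨a + (b - d), by rw [ha, hb, hd]; push_cast; ring⟩
  · intro x
    rw [hG]
    have h1 : (⟨P x, hP1 x⟩ : X) = x := Subtype.ext (hP2 x x.2)
    rw [h1, hP2 x x.2]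
    ring
  · intro v
    rw [hG, ← hF1]
    have h1 := hg2 (L v)
    have h2 : ‖L v‖ ≤ (‖L‖ + 1) * c * N v := by
      refine (L.le_opNorm v).trans ?_
      have := hc v
      have h0 := norm_nonneg v
      have h3 := norm_nonneg L
      nlinarith
    have h3 : |g (L v) - F (L v)| ≤ δ * N v := by
      refine h1.trans ?_
      rw [div_mul_eq_mul_div, div_le_iff₀ hK]
      have := mul_le_mul_of_nonneg_left h2 hδ.le
      linarith
    rw [hL, map_sub, map_sub] at h3
    have h4 := hF2 v
    have h5 : F (P v) + (g v - g (P v)) = F v + (g v - g (P v) - (F v - F (P v))) := by ring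
    simp only [h5]
    refine (abs_add_le _ _).trans ?_
    linarith

/-- If the restriction of a norm `N` on `ℝ^m` to a subspace `X` spanned by rational vectors
is rational, then for every `δ > 0` there is a rational norm `N'` on `ℝ^m` that is
`δ`-equivalent to `N` and agrees with `N` on `X`. -/
theorem rational_norm_extension
    (m : ℕ) (N : (Fin m → ℝ) → ℝ) (hN : IsNormOn m N)
    (X : Submodule ℝ (Fin m → ℝ))
    (hXrat : X = Submodule.span ℝ {v | v ∈ X ∧ IsRationalVec v})
    (k : ℕ) (φ : Fin k → (↥X →ₗ[ℝ] ℝ))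
    (hφrat : ∀ (i : Fin k) (x : ↥X), IsRationalVec (x : Fin m → ℝ) → ∃ q : ℚ, φ i x = (q : ℝ))
    (hφnorm : ∀ x : ↥X, N (x : Fin m → ℝ) = ⨆ i, |φ i x|)
    (δ : ℝ) (hδ : 0 < δ) :
    ∃ N' : (Fin m → ℝ) → ℝ, IsNormOn m N' ∧ IsRationalNorm m N' ∧
      (∀ y, (1 + δ)⁻¹ * N y ≤ N' y ∧ N' y ≤ (1 + δ) * N y) ∧
      (∀ x ∈ X, N' x = N x) := by
  have hr0 : 0 < (1 + δ)⁻¹ := by positivity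
  have hr1 : (1 + δ)⁻¹ < 1 := inv_lt_one_of_one_lt₀ (by linarith)
  have hcont := norm_cont hN
  have hφle : ∀ i (x : X), |φ i x| ≤ N x := by
    intro i x
    rw [hφnorm]
    exact le_ciSup (f := fun i => |φ i x|) (Set.finite_range _).bddAbove i
  have hE := fun i => rat_ext hN X hXrat (φ i) (hφrat i)
    (fun x => (le_abs_self _).trans (hφle i x)) δ hδ
  choose Ψ hΨ1 hΨ2 hΨ3 using hE
  have hS : ∀ y : Metric.sphere (0 : Fin m → ℝ) 1, (y : Fin m → ℝ) ≠ 0 := by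
    intro y h
    have := y.2
    rw [h] at this
    simp at this
  have hG := fun y : Metric.sphere (0 : Fin m → ℝ) 1 => rat_norming hN y (hS y) _ hr0 hr1
  choose G hG1 hG2 hG3 using hG
  obtain ⟨T, hT⟩ := (isCompact_sphere (0 : Fin m → ℝ) 1).elim_finite_subcover
    (fun y => {z | (1 + δ)⁻¹ * N z < |G y z|})
    (fun y => isOpen_lt (continuous_const.mul hcont)
      (LinearMap.continuous_of_finiteDimensional (G y)).abs)
    (fun z hz => Set.mem_iUnion.2 ⟨⟨z, hz⟩, hG2 ⟨z, hz⟩⟩)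
  let e := Fintype.equivFin (Fin k ⊕ T)
  let ψ : Fin k ⊕ T → ((Fin m → ℝ) →ₗ[ℝ] ℝ) := Sum.elim Ψ (fun t => G t)
  have hle : ∀ v j, |ψ j v| ≤ ⨆ j, |ψ j v| := fun v j =>
    le_ciSup (f := fun j => |ψ j v|) (Set.finite_range _).bddAbove j
  have hnn : ∀ v, 0 ≤ ⨆ j, |ψ j v| := fun v => Real.iSup_nonneg fun j => abs_nonneg _
  have hlow : ∀ y, (1 + δ)⁻¹ * N y ≤ ⨆ j, |ψ j y| := by
    intro y
    by_cases hy : y = 0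
    · rw [(hN.2.1 y).2 hy, mul_zero]
      exact hnn y
    have hvp : 0 < ‖y‖ := norm_pos_iff.2 hy
    have hm : ‖y‖⁻¹ • y ∈ Metric.sphere (0 : Fin m → ℝ) 1 := by
      simp [norm_smul, hvp.ne']
    obtain ⟨t, ht, h⟩ := Set.mem_iUnion₂.1 (hT hm)
    simp only [Set.mem_ofPred_eq] at h
    rw [hN.2.2.1, map_smul, smul_eq_mul, abs_mul, mul_left_comm] at h
    have h' := lt_of_mul_lt_mul_left h (abs_nonneg _)
    exact h'.le.trans (hle y (Sum.inr ⟨t, ht⟩))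
  have hup : ∀ y, ⨆ j, |ψ j y| ≤ (1 + δ) * N y := by
    intro y
    have h0 := hN.1 y
    refine Real.iSup_le ?_ (by positivity)
    rintro (i | t)
    · exact hΨ3 i y
    · refine (hG3 t y).trans ?_
      nlinarith
  refine ⟨fun v => ⨆ j, |ψ j v|, ⟨hnn, fun v => ⟨fun h => ?_, fun h => ?_⟩, fun a v => ?_,
    fun v w => ?_⟩, ⟨_, fun i => ψ (e.symm i), ?_, ?_⟩, fun y => ⟨hlow y, hup y⟩, ?_⟩
  · have h1 := hlow v
    have h2 := hN.1 v
    refine (hN.2.1 v).1 (le_antisymm ?_ h2)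
    simp only at h
    rw [h] at h1
    by_contra hh
    push Not at hh
    have := mul_pos hr0 hh
    linarith
  · subst h
    simp
  · simp only [map_smul, smul_eq_mul, abs_mul]
    rw [Real.mul_iSup_of_nonneg (abs_nonneg a)]
  · refine Real.iSup_le (fun j => ?_) (add_nonneg (hnn v) (hnn w))
    rw [map_add]
    exact (abs_add_le _ _).trans (add_le_add (hle v j) (hle w j))
  · intro i v hv
    change ∃ q : ℚ, ψ (e.symm i) v = (q : ℝ)
    rcases e.symm i with j | t
    · exact hΨ1 j v hv
    · exact hG1 t v hv
  · intro v
    exact (e.symm.iSup_comp (g := fun j => |ψ j v|)).symm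
  · intro x hx
    refine le_antisymm (Real.iSup_le ?_ (hN.1 x)) ?_
    · rintro (i | t)
      · have := hΨ2 i ⟨x, hx⟩
        simp only [ψ, Sum.elim_inl]
        simp only at this
        rw [this]
        exact hφle i ⟨x, hx⟩
      · exact hG3 t x
    · have h1 := hφnorm ⟨x, hx⟩
      simp only at h1
      rw [h1]
      refine Real.iSup_le (fun i => ?_) (hnn x)
      rw [← hΨ2 i ⟨x, hx⟩]
      exact hle x (Sum.inl i)
end

section
/- There exist separable Banach spaces U, V and a nonexpansive linear operator F: U→V satisfying condition (G*); in particular F has the Gurarii property. -/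
/-- Condition (G): the Gurarii property of an operator `Ω : U → V`. -/
def HasGurariiProperty {U V : Type*} [NormedAddCommGroup U] [NormedSpace ℝ U]
    [NormedAddCommGroup V] [NormedSpace ℝ V] (Ω : U →L[ℝ] V) : Prop :=
  ∀ (ε : ℝ), 0 < ε →
    ∀ (X Y : Type) [NormedAddCommGroup X] [NormedSpace ℝ X] [FiniteDimensional ℝ X]
      [NormedAddCommGroup Y] [NormedSpace ℝ Y] [FiniteDimensional ℝ Y]
      (X₀ : Submodule ℝ X) (Y₀ : Submodule ℝ Y) (T : X →L[ℝ] Y),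
      ‖T‖ ≤ 1 →
      ∀ (hT : ∀ x ∈ X₀, T x ∈ Y₀) (i : X₀ →ₗᵢ[ℝ] U) (j : Y₀ →ₗᵢ[ℝ] V),
        (∀ x : X₀, Ω (i x) = j ⟨T x, hT x x.2⟩) →
        ∃ (i' : X →L[ℝ] U) (j' : Y →L[ℝ] V),
          IsEpsIsometry ε i' ∧ IsEpsIsometry ε j' ∧
          ‖i'.comp X₀.subtypeL - i.toContinuousLinearMap‖ < ε ∧
          ‖j'.comp Y₀.subtypeL - j.toContinuousLinearMap‖ < ε ∧
          ‖Ω.comp i' - j'.comp T‖ < ε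

/-- Condition (G*): as (G) but with exact commutation `Ω ∘ i' = j' ∘ T`. -/
def HasGurariiStarProperty {U V : Type*} [NormedAddCommGroup U] [NormedSpace ℝ U]
    [NormedAddCommGroup V] [NormedSpace ℝ V] (Ω : U →L[ℝ] V) : Prop :=
  ∀ (ε : ℝ), 0 < ε →
    ∀ (X Y : Type) [NormedAddCommGroup X] [NormedSpace ℝ X] [FiniteDimensional ℝ X]
      [NormedAddCommGroup Y] [NormedSpace ℝ Y] [FiniteDimensional ℝ Y]
      (X₀ : Submodule ℝ X) (Y₀ : Submodule ℝ Y) (T : X →L[ℝ] Y),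
      ‖T‖ ≤ 1 →
      ∀ (hT : ∀ x ∈ X₀, T x ∈ Y₀) (i : X₀ →ₗᵢ[ℝ] U) (j : Y₀ →ₗᵢ[ℝ] V),
        (∀ x : X₀, Ω (i x) = j ⟨T x, hT x x.2⟩) →
        ∃ (i' : X →L[ℝ] U) (j' : Y →L[ℝ] V),
          IsEpsIsometry ε i' ∧ IsEpsIsometry ε j' ∧
          ‖i'.comp X₀.subtypeL - i.toContinuousLinearMap‖ < ε ∧
          ‖j'.comp Y₀.subtypeL - j.toContinuousLinearMap‖ < ε ∧
          Ω.comp i' = j'.comp T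

/-- Condition (g): the defining extension property of the Gurarii space. -/
def SatisfiesConditionSmallG (W : Type*) [NormedAddCommGroup W] [NormedSpace ℝ W] : Prop :=
  ∀ (ε : ℝ), 0 < ε →
    ∀ (X : Type) [NormedAddCommGroup X] [NormedSpace ℝ X] [FiniteDimensional ℝ X]
      (X₀ : Submodule ℝ X) (i : X₀ →ₗᵢ[ℝ] W),
      ∃ f : X →L[ℝ] W, IsEpsIsometry ε f ∧
        ‖f.comp X₀.subtypeL - i.toContinuousLinearMap‖ ≤ ε

open TopologicalSpace

namespace GurariiAux

/-- The amalgam seminorm on `U × A`. -/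
noncomputable def amalg {U A : Type} [SeminormedAddCommGroup U] [NormedSpace ℝ U]
    [AddCommGroup A] [Module ℝ A] (p w : Seminorm ℝ A) (i : A →ₗ[ℝ] U) :
    Seminorm ℝ (U × A) :=
  Seminorm.ofSMulLE (fun v => ⨅ z : A, (‖v.1 + i z‖ + p (v.2 - z) + w z))
    (by
      apply le_antisymm
      · refine ciInf_le_of_le ⟨0, ?_⟩ 0 (by simp)
        rintro _ ⟨z, rfl⟩
        positivity
      · exact le_ciInf fun z => by positivity)
    (by
      intro x y
      have hb : ∀ v : U × A, BddBelow (Set.range fun z : A =>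
          (‖v.1 + i z‖ + p (v.2 - z) + w z)) := fun v => ⟨0, by
        rintro _ ⟨z, rfl⟩
        positivity⟩
      refine le_ciInf_add_ciInf fun z z' => ?_
      refine ciInf_le_of_le (hb _) (z + z') ?_
      have h1 : ‖(x + y).1 + i (z + z')‖ ≤ ‖x.1 + i z‖ + ‖y.1 + i z'‖ := by
        have : (x + y).1 + i (z + z') = (x.1 + i z) + (y.1 + i z') := by
          simp only [Prod.fst_add, map_add]; abel
        rw [this]; exact norm_add_le _ _
      have h2 : p ((x + y).2 - (z + z')) ≤ p (x.2 - z) + p (y.2 - z') := by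
        have : (x + y).2 - (z + z') = (x.2 - z) + (y.2 - z') := by
          simp only [Prod.snd_add]; abel
        rw [this]; exact map_add_le_add p _ _
      have h3 := map_add_le_add w z z'
      linarith)
    (by
      intro r x
      have hb : ∀ v : U × A, BddBelow (Set.range fun z : A =>
          (‖v.1 + i z‖ + p (v.2 - z) + w z)) := fun v => ⟨0, by
        rintro _ ⟨z, rfl⟩
        positivity⟩
      rw [Real.mul_iInf_of_nonneg (norm_nonneg r)]
      refine le_ciInf fun z => ?_
      refine ciInf_le_of_le (hb _) (r • z) ?_
      have h1 : (r • x).1 + i (r • z) = r • (x.1 + i z) := by simp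
      have h2 : (r • x).2 - r • z = r • (x.2 - z) := by simp [smul_sub]
      rw [h1, h2, norm_smul, map_smul_eq_mul, map_smul_eq_mul]
      apply le_of_eq; ring)

section amalg
variable {U A : Type} [SeminormedAddCommGroup U] [NormedSpace ℝ U]
    [AddCommGroup A] [Module ℝ A] (p w : Seminorm ℝ A) (i : A →ₗ[ℝ] U)

theorem amalg_le (v : U × A) (z : A) :
    amalg p w i v ≤ ‖v.1 + i z‖ + p (v.2 - z) + w z := by
  refine ciInf_le (f := fun z : A => (‖v.1 + i z‖ + p (v.2 - z) + w z)) ⟨0, ?_⟩ z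
  rintro _ ⟨z, rfl⟩
  positivity

theorem le_amalg (v : U × A) (c : ℝ) (h : ∀ z, c ≤ ‖v.1 + i z‖ + p (v.2 - z) + w z) :
    c ≤ amalg p w i v := le_ciInf h

theorem amalg_inl (h : ∀ z, ‖i z‖ ≤ p z + w z) (u : U) : amalg p w i (u, 0) = ‖u‖ := by
  apply le_antisymm
  · simpa using amalg_le p w i (u, 0) 0
  · refine le_amalg _ _ _ _ _ fun z => ?_
    have h1 : ‖u‖ ≤ ‖u + i z‖ + ‖i z‖ := by
      simpa using norm_sub_le (u + i z) (i z)
    have h2 := h z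
    have h3 : p (0 - z) = p z := by rw [zero_sub, map_neg_eq_map]
    simp only [h3]
    linarith

theorem amalg_inr_le (x : A) : amalg p w i (0, x) ≤ p x := by
  simpa using amalg_le p w i (0, x) 0

theorem amalg_diff_le (x : A) : amalg p w i (-(i x), x) ≤ w x := by
  simpa using amalg_le p w i (-(i x), x) x

end amalg

/-- Sum of seminorms on finitely supported functions. -/
noncomputable def sumSem {S X : Type} [AddCommGroup X] [Module ℝ X] (p : S → Seminorm ℝ X) :
    Seminorm ℝ (S →₀ X) :=
  Seminorm.ofSMulLE (fun x => x.sum fun s z => p s z) (by simp)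
    (by
      classical
      intro x y
      rw [Finsupp.sum_of_support_subset (x + y) Finsupp.support_add _ (by simp),
        Finsupp.sum_of_support_subset x (s := x.support ∪ y.support)
          Finset.subset_union_left _ (by simp),
        Finsupp.sum_of_support_subset y (s := x.support ∪ y.support)
          Finset.subset_union_right _ (by simp), ← Finset.sum_add_distrib]
      exact Finset.sum_le_sum fun s _ => map_add_le_add (p s) _ _)
    (by
      intro r x
      rw [Finsupp.sum_of_support_subset (r • x) Finsupp.support_smul _ (by simp),
        Finsupp.sum, Finset.mul_sum]
      refine le_of_eq (Finset.sum_congr rfl fun s _ => ?_)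
      simp [map_smul_eq_mul])

theorem sumSem_apply {S X : Type} [AddCommGroup X] [Module ℝ X] (p : S → Seminorm ℝ X)
    (x : S →₀ X) : sumSem p x = x.sum fun s z => p s z := rfl

theorem sumSem_single {S X : Type} [AddCommGroup X] [Module ℝ X] (p : S → Seminorm ℝ X)
    (s : S) (x : X) : sumSem p (Finsupp.single s x) = p s x := by
  rw [sumSem_apply, Finsupp.sum_single_index (by simp)]

theorem sumSem_mono {S X : Type} [AddCommGroup X] [Module ℝ X] (p q : S → Seminorm ℝ X)
    (h : ∀ s x, p s x ≤ q s x) (x : S →₀ X) : sumSem p x ≤ sumSem q x :=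
  Finset.sum_le_sum fun s _ => h s _

/-- splitting off one coordinate -/
theorem sumSem_split {S X : Type} [AddCommGroup X] [Module ℝ X] (p : S → Seminorm ℝ X)
    (s : S) (x : S →₀ X) : sumSem p x = p s (x s) + sumSem p (x.erase s) := by
  classical
  rw [sumSem_apply, sumSem_apply]
  by_cases hs : s ∈ x.support
  · rw [← Finsupp.add_sum_erase x s _ hs]
  · have h0 : x s = 0 := by simpa using hs
    rw [Finsupp.erase_of_notMem_support hs, h0]; simp

/-- Type synonym carrying the seminorm `N`. -/
def SN {M : Type} [AddCommGroup M] [Module ℝ M] (_N : Seminorm ℝ M) : Type := M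

noncomputable instance {M : Type} [AddCommGroup M] [Module ℝ M] (N : Seminorm ℝ M) :
    SeminormedAddCommGroup (SN N) :=
  AddGroupSeminorm.toSeminormedAddCommGroup (E := M) N.toAddGroupSeminorm

noncomputable instance {M : Type} [AddCommGroup M] [im : Module ℝ M] (N : Seminorm ℝ M) :
    NormedSpace ℝ (SN N) where
  __ := im
  norm_smul_le r x := (map_smul_eq_mul N r x).le

/-- the identity -/
noncomputable def SN.of {M : Type} [AddCommGroup M] [Module ℝ M] (N : Seminorm ℝ M) :
    M ≃ₗ[ℝ] SN N := LinearEquiv.refl ℝ M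

theorem SN.norm_of {M : Type} [AddCommGroup M] [Module ℝ M] (N : Seminorm ℝ M) (x : M) :
    ‖SN.of N x‖ = N x := rfl

/-- A seminormed separable pair with nonexpansive operator. -/
structure Stage where
  U : Type
  V : Type
  [iU : SeminormedAddCommGroup U]
  [nU : NormedSpace ℝ U]
  [iV : SeminormedAddCommGroup V]
  [nV : NormedSpace ℝ V]
  Om : U →ₗ[ℝ] V
  hOm : ∀ u, ‖Om u‖ ≤ ‖u‖
  sU : SeparableSpace U
  sV : SeparableSpace V

attribute [instance] Stage.iU Stage.nU Stage.iV Stage.nV Stage.sU Stage.sV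

/-- An (approximate) extension problem. -/
structure Prob {U V X Y : Type} [SeminormedAddCommGroup U] [NormedSpace ℝ U]
    [SeminormedAddCommGroup V] [NormedSpace ℝ V]
    [NormedAddCommGroup X] [NormedSpace ℝ X]
    [NormedAddCommGroup Y] [NormedSpace ℝ Y]
    (Om : U →ₗ[ℝ] V) (T : X →ₗ[ℝ] Y) where
  i : X →ₗ[ℝ] U
  j : Y →ₗ[ℝ] V
  p : Seminorm ℝ X
  w : Seminorm ℝ X
  q : Seminorm ℝ Y
  v : Seminorm ℝ Y
  cp : Continuous p
  cw : Continuous w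
  cq : Continuous q
  cv : Continuous v
  hi1 : ∀ z, ‖i z‖ ≤ p z + w z
  hi2 : ∀ z, p z ≤ ‖i z‖ + w z
  hj1 : ∀ z, ‖j z‖ ≤ q z + v z
  hj2 : ∀ z, q z ≤ ‖j z‖ + v z
  hT : ∀ z, q (T z) ≤ p z
  hc : ∀ z, ‖Om (i z) - j (T z)‖ + v (T z) ≤ w z


theorem sep_amalg {U X S : Type} [SeminormedAddCommGroup U] [NormedSpace ℝ U] [SeparableSpace U]
    [NormedAddCommGroup X] [NormedSpace ℝ X] [SeparableSpace X] [Countable S]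
    (p w : S → Seminorm ℝ X) (i : (S →₀ X) →ₗ[ℝ] U) (cp : ∀ s, Continuous (p s)) :
    SeparableSpace (SN (amalg (sumSem p) (sumSem w) i)) := by
  set N := amalg (sumSem p) (sumSem w) i with hN
  have cl : Continuous fun u : U => SN.of N (u, 0) := by
    let f : U →ₗ[ℝ] SN N := (SN.of N).toLinearMap ∘ₗ LinearMap.inl ℝ U (S →₀ X)
    refine (f.mkContinuous 1 fun u => ?_).continuous
    have := amalg_le (sumSem p) (sumSem w) i (u, 0) 0
    change N (u, 0) ≤ 1 * ‖u‖
    simpa using this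
  have cr : ∀ s, Continuous fun x : X => SN.of N (0, Finsupp.single s x) := by
    intro s
    let f : X →ₗ[ℝ] SN N := (SN.of N).toLinearMap ∘ₗ LinearMap.inr ℝ U (S →₀ X) ∘ₗ
      Finsupp.lsingle s
    obtain ⟨C, _, hC⟩ := (p s).bound_of_continuous_normedSpace (cp s)
    refine (f.mkContinuous C fun x => ?_).continuous
    refine le_trans ?_ (hC x)
    change N (0, Finsupp.single s x) ≤ p s x
    rw [← sumSem_single p s x]
    exact amalg_inr_le _ _ _ _
  have hs : IsSeparable (Set.range (fun u : U => SN.of N (u, 0)) ∪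
      ⋃ s, Set.range (fun x : X => SN.of N (0, Finsupp.single s x))) :=
    (isSeparable_range cl).union (IsSeparable.iUnion fun s => isSeparable_range (cr s))
  have h2 := hs.span (R := ℝ)
  rw [← isSeparable_univ_iff]
  refine h2.mono fun y _ => ?_
  obtain ⟨⟨u, x⟩, rfl⟩ := (SN.of N).surjective y
  have e : (u, x) = (u, (0 : S →₀ X)) + (0, x) := by simp
  rw [SetLike.mem_coe, e, map_add]
  refine Submodule.add_mem _ (Submodule.subset_span (Or.inl ⟨u, rfl⟩)) ?_
  clear e
  induction x using Finsupp.induction_linear with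
  | zero =>
    have : ((0 : U), (0 : S →₀ X)) = 0 := rfl
    rw [this, map_zero]; exact Submodule.zero_mem _
  | add f g hf hg =>
    have : ((0 : U), f + g) = (0, f) + (0, g) := by simp
    rw [this, map_add]
    exact Submodule.add_mem _ (hf trivial) (hg trivial)
  | single s z =>
    exact Submodule.subset_span (Or.inr (Set.mem_iUnion.2 ⟨s, z, rfl⟩))

/-- `b` is a solution of `P` up to `η`. -/
structure IsSol {U V U' V' X Y : Type} [SeminormedAddCommGroup U] [NormedSpace ℝ U]
    [SeminormedAddCommGroup V] [NormedSpace ℝ V]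
    [SeminormedAddCommGroup U'] [NormedSpace ℝ U']
    [SeminormedAddCommGroup V'] [NormedSpace ℝ V']
    [NormedAddCommGroup X] [NormedSpace ℝ X]
    [NormedAddCommGroup Y] [NormedSpace ℝ Y]
    {Om : U →ₗ[ℝ] V} {T : X →ₗ[ℝ] Y} (Om' : U' →ₗ[ℝ] V') (f : U → U') (g : V → V')
    (P : Prob Om T) (η : ℝ) (i' : X →ₗ[ℝ] U') (j' : Y →ₗ[ℝ] V') : Prop where
  i1 : ∀ z, ‖i' z‖ ≤ P.p z + η * ‖z‖
  i2 : ∀ z, P.p z ≤ ‖i' z‖ + η * ‖z‖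
  i3 : ∀ z, ‖i' z - f (P.i z)‖ ≤ P.w z + η * ‖z‖
  j1 : ∀ z, ‖j' z‖ ≤ P.q z + η * ‖z‖
  j2 : ∀ z, P.q z ≤ ‖j' z‖ + η * ‖z‖
  j3 : ∀ z, ‖j' z - g (P.j z)‖ ≤ P.v z + η * ‖z‖
  comm : ∀ z, Om' (i' z) = j' (T z)

theorem dense_prob {U V X Y : Type} [SeminormedAddCommGroup U] [NormedSpace ℝ U]
    [SeminormedAddCommGroup V] [NormedSpace ℝ V] [SeparableSpace U] [SeparableSpace V]
    [NormedAddCommGroup X] [NormedSpace ℝ X] [FiniteDimensional ℝ X]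
    [NormedAddCommGroup Y] [NormedSpace ℝ Y] [FiniteDimensional ℝ Y]
    (Om : U →ₗ[ℝ] V) (T : X →ₗ[ℝ] Y) :
    ∃ S : Set (Prob Om T), S.Countable ∧ ∀ P : Prob Om T, ∀ η > 0, ∃ P' ∈ S,
      (∀ z, ‖P'.i z - P.i z‖ ≤ η * ‖z‖) ∧ (∀ z, |P'.p z - P.p z| ≤ η * ‖z‖) ∧
      (∀ z, |P'.w z - P.w z| ≤ η * ‖z‖) ∧
      (∀ z, ‖P'.j z - P.j z‖ ≤ η * ‖z‖) ∧ (∀ z, |P'.q z - P.q z| ≤ η * ‖z‖) ∧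
      (∀ z, |P'.v z - P.v z| ≤ η * ‖z‖) := by
  have := UniformSpace.secondCountable_of_separable U
  have := UniformSpace.secondCountable_of_separable V
  have : ProperSpace X := FiniteDimensional.proper ℝ X
  have : ProperSpace Y := FiniteDimensional.proper ℝ Y
  let BX := Metric.closedBall (0 : X) 1
  let BY := Metric.closedBall (0 : Y) 1
  have : CompactSpace BX := isCompact_iff_compactSpace.1 (isCompact_closedBall _ _)
  have : CompactSpace BY := isCompact_iff_compactSpace.1 (isCompact_closedBall _ _)
  have ci : ∀ P : Prob Om T, Continuous P.i := fun P => P.i.continuous_of_finiteDimensional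
  have cj : ∀ P : Prob Om T, Continuous P.j := fun P => P.j.continuous_of_finiteDimensional
  let Φ : Prob Om T → C(BX, U × ℝ × ℝ) × C(BY, V × ℝ × ℝ) := fun P =>
    (⟨fun z => (P.i z, P.p z, P.w z), by
      have := ci P; have := P.cp; have := P.cw; fun_prop⟩,
     ⟨fun z => (P.j z, P.q z, P.v z), by
      have := cj P; have := P.cq; have := P.cv; fun_prop⟩)
  let t : TopologicalSpace (Prob Om T) := TopologicalSpace.induced Φ inferInstance
  let m : PseudoMetricSpace (Prob Om T) := PseudoMetricSpace.induced Φ inferInstance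
  have : SecondCountableTopology (Prob Om T) := secondCountableTopology_induced _ _ Φ
  obtain ⟨S, hS, hd⟩ := TopologicalSpace.exists_countable_dense (Prob Om T)
  refine ⟨S, hS, fun P η hη => ?_⟩
  obtain ⟨P', hP', hlt⟩ := hd.exists_dist_lt P hη
  have hlt : dist (Φ P) (Φ P') < η := hlt
  rw [dist_comm, Prod.dist_eq, max_lt_iff] at hlt
  have hX : ∀ z : X, ‖z‖ ≤ 1 → ‖P'.i z - P.i z‖ ≤ η ∧ |P'.p z - P.p z| ≤ η ∧
      |P'.w z - P.w z| ≤ η := by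
    intro z hz
    have h := (ContinuousMap.dist_apply_le_dist (f := (Φ P').1) (g := (Φ P).1)
      ⟨z, by simpa [BX] using hz⟩).trans hlt.1.le
    change dist (P'.i z, P'.p z, P'.w z) (P.i z, P.p z, P.w z) ≤ η at h
    simpa [Prod.dist_eq, dist_eq_norm, Real.norm_eq_abs, SeminormedAddGroup.dist_eq] using h
  have hY : ∀ z : Y, ‖z‖ ≤ 1 → ‖P'.j z - P.j z‖ ≤ η ∧ |P'.q z - P.q z| ≤ η ∧
      |P'.v z - P.v z| ≤ η := by
    intro z hz
    have h := (ContinuousMap.dist_apply_le_dist (f := (Φ P').2) (g := (Φ P).2)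
      ⟨z, by simpa [BY] using hz⟩).trans hlt.2.le
    change dist (P'.j z, P'.q z, P'.v z) (P.j z, P.q z, P.v z) ≤ η at h
    simpa [Prod.dist_eq, dist_eq_norm, Real.norm_eq_abs, SeminormedAddGroup.dist_eq] using h
  have scale : ∀ {Z : Type} [NormedAddCommGroup Z] [NormedSpace ℝ Z] (F : Z → ℝ),
      (∀ (r : ℝ) z, 0 ≤ r → F (r • z) = r * F z) → (∀ z, ‖z‖ ≤ 1 → F z ≤ η) →
      ∀ z, F z ≤ η * ‖z‖ := by
    intro Z _ _ F hF hb z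
    by_cases hz : z = 0
    · have := hF 0 0 le_rfl
      simp only [smul_zero, zero_mul] at this
      rw [hz, this]; simp
    have hz' : ‖z‖ ≠ 0 := by simpa using hz
    have e : z = ‖z‖ • (‖z‖⁻¹ • z) := by rw [smul_smul, mul_inv_cancel₀ hz', one_smul]
    calc F z = ‖z‖ * F (‖z‖⁻¹ • z) := by rw [← hF _ _ (norm_nonneg z), ← e]
      _ ≤ ‖z‖ * η := by
        refine mul_le_mul_of_nonneg_left (hb _ ?_) (norm_nonneg z)
        rw [norm_smul, norm_inv, norm_norm, inv_mul_cancel₀ hz']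
      _ = _ := mul_comm _ _
  have sn : ∀ {Z : Type} [NormedAddCommGroup Z] [NormedSpace ℝ Z] (a b : Seminorm ℝ Z)
      (r : ℝ) (z : Z), 0 ≤ r → |a (r • z) - b (r • z)| = r * |a z - b z| := by
    intro Z _ _ a b r z hr
    rw [map_smul_eq_mul, map_smul_eq_mul, ← mul_sub, abs_mul, Real.norm_eq_abs, abs_abs,
      abs_of_nonneg hr]
  have sl : ∀ {Z W : Type} [NormedAddCommGroup Z] [NormedSpace ℝ Z] [SeminormedAddCommGroup W]
      [NormedSpace ℝ W] (a b : Z →ₗ[ℝ] W)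
      (r : ℝ) (z : Z), 0 ≤ r → ‖a (r • z) - b (r • z)‖ = r * ‖a z - b z‖ := by
    intro Z W _ _ _ _ a b r z hr
    rw [map_smul, map_smul, ← smul_sub, norm_smul, Real.norm_eq_abs, abs_of_nonneg hr]
  exact ⟨P', hP',
    scale _ (sl P'.i P.i) fun z hz => (hX z hz).1,
    scale _ (sn P'.p P.p) fun z hz => (hX z hz).2.1,
    scale _ (sn P'.w P.w) fun z hz => (hX z hz).2.2,
    scale _ (sl P'.j P.j) fun z hz => (hY z hz).1,
    scale _ (sn P'.q P.q) fun z hz => (hY z hz).2.1,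
    scale _ (sn P'.v P.v) fun z hz => (hY z hz).2.2⟩

section side
variable {U X S : Type} [SeminormedAddCommGroup U] [NormedSpace ℝ U]
    [NormedAddCommGroup X] [NormedSpace ℝ X]
    (p w : S → Seminorm ℝ X) (i : S → X →ₗ[ℝ] U)

theorem norm_lsum_le (h1 : ∀ s z, ‖i s z‖ ≤ p s z + w s z) (z : S →₀ X) :
    ‖Finsupp.lsum ℝ i z‖ ≤ sumSem p z + sumSem w z := by
  rw [Finsupp.lsum_apply, sumSem_apply, sumSem_apply, Finsupp.sum, Finsupp.sum, Finsupp.sum,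
    ← Finset.sum_add_distrib]
  exact (norm_sum_le _ _).trans (Finset.sum_le_sum fun s _ => h1 s _)

theorem amalg_single (h1 : ∀ s z, ‖i s z‖ ≤ p s z + w s z)
    (h2 : ∀ s z, p s z ≤ ‖i s z‖ + w s z) (s : S) (x : X) :
    amalg (sumSem p) (sumSem w) (Finsupp.lsum ℝ i) (0, Finsupp.single s x) = p s x := by
  apply le_antisymm
  · rw [← sumSem_single p s x]; exact amalg_inr_le _ _ _ _
  · refine le_amalg _ _ _ _ _ fun z => ?_
    have ez : z = Finsupp.single s (z s) + z.erase s := (Finsupp.single_add_erase s z).symm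
    have a1 := norm_lsum_le p w i h1 (z.erase s)
    have a2 : ‖i s (z s)‖ ≤ ‖Finsupp.lsum ℝ i z‖ + ‖Finsupp.lsum ℝ i (z.erase s)‖ := by
      have : Finsupp.lsum ℝ i z = i s (z s) + Finsupp.lsum ℝ i (z.erase s) := by
        conv_lhs => rw [ez]
        rw [map_add]; simp
      rw [this]
      simpa using norm_sub_le (i s (z s) + Finsupp.lsum ℝ i (z.erase s))
        (Finsupp.lsum ℝ i (z.erase s))
    have a3 : sumSem p (Finsupp.single s x - z) = p s (x - z s) + sumSem p (z.erase s) := by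
      have : (Finsupp.single s x - z).erase s = -(z.erase s) := by
        ext t
        by_cases h : t = s
        · subst h; simp
        · simp [Finsupp.erase_ne h]
      rw [sumSem_split p s, this, map_neg_eq_map]; simp
    have a4 := sumSem_split w s z
    have a5 := h2 s (z s)
    have a6 : p s x ≤ p s (x - z s) + p s (z s) := by
      simpa using map_add_le_add (p s) (x - z s) (z s)
    simp only [zero_add]
    rw [a3, a4]
    linarith
end side

/-- A stage extends another one and solves all problems of shape `T`. -/
def Good {X Y : Type} [NormedAddCommGroup X] [NormedSpace ℝ X]
    [NormedAddCommGroup Y] [NormedSpace ℝ Y] (T : X →ₗ[ℝ] Y) (S S' : Stage) : Prop :=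
  ∃ (f : S.U →ₗᵢ[ℝ] S'.U) (g : S.V →ₗᵢ[ℝ] S'.V), (∀ u, S'.Om (f u) = g (S.Om u)) ∧
    ∀ P : Prob S.Om T, ∀ η > 0, ∃ i' j', IsSol S'.Om f g P η i' j'

theorem exists_step {X Y : Type} [NormedAddCommGroup X] [NormedSpace ℝ X] [FiniteDimensional ℝ X]
    [NormedAddCommGroup Y] [NormedSpace ℝ Y] [FiniteDimensional ℝ Y] (T : X →ₗ[ℝ] Y)
    (St : Stage) : ∃ St' : Stage, Good T St St' := by
  obtain ⟨S, hS, hd⟩ := dense_prob St.Om T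
  have : Countable S := hS.to_subtype
  have : ProperSpace X := FiniteDimensional.proper ℝ X
  have : ProperSpace Y := FiniteDimensional.proper ℝ Y
  let ib := Finsupp.lsum ℝ (fun s : S => s.1.i)
  let jb := Finsupp.lsum ℝ (fun s : S => s.1.j)
  let pb := sumSem (fun s : S => s.1.p)
  let wb := sumSem (fun s : S => s.1.w)
  let qb := sumSem (fun s : S => s.1.q)
  let vb := sumSem (fun s : S => s.1.v)
  let Tb : (S →₀ X) →ₗ[ℝ] (S →₀ Y) := Finsupp.mapRange.linearMap T
  let N := amalg pb wb ib
  let M := amalg qb vb jb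
  have hNl : ∀ u, N (u, 0) = ‖u‖ := fun u =>
    amalg_inl _ _ _ (norm_lsum_le _ _ _ fun s z => s.1.hi1 z) u
  have hMl : ∀ u, M (u, 0) = ‖u‖ := fun u =>
    amalg_inl _ _ _ (norm_lsum_le _ _ _ fun s z => s.1.hj1 z) u
  have hNr : ∀ s x, N (0, Finsupp.single s x) = s.1.p x :=
    amalg_single _ _ _ (fun s z => s.1.hi1 z) (fun s z => s.1.hi2 z)
  have hMr : ∀ s x, M (0, Finsupp.single s x) = s.1.q x :=
    amalg_single _ _ _ (fun s z => s.1.hj1 z) (fun s z => s.1.hj2 z)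
  let O : SN N →ₗ[ℝ] SN M := (SN.of M).toLinearMap ∘ₗ (LinearMap.prodMap St.Om Tb) ∘ₗ
    (SN.of N).symm.toLinearMap
  have hT1 : ∀ z, qb (Tb z) ≤ pb z := by
    intro z
    have e : qb (Tb z) = z.sum fun s x => s.1.q (T x) := by
      change (Finsupp.mapRange T (map_zero T) z).sum _ = _
      rw [Finsupp.sum_mapRange_index (by simp)]
    rw [e]
    exact Finset.sum_le_sum fun s _ => s.1.hT _
  have hT2 : ∀ z, ‖St.Om (ib z) - jb (Tb z)‖ + vb (Tb z) ≤ wb z := by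
    intro z
    have e : vb (Tb z) = z.sum fun s x => s.1.v (T x) := by
      change (Finsupp.mapRange T (map_zero T) z).sum _ = _
      rw [Finsupp.sum_mapRange_index (by simp)]
    have e2 : jb (Tb z) = z.sum fun s x => s.1.j (T x) := by
      change Finsupp.lsum ℝ _ (Finsupp.mapRange T (map_zero T) z) = _
      rw [Finsupp.lsum_apply, Finsupp.sum_mapRange_index (by simp)]
    have e3 : St.Om (ib z) = z.sum fun s x => St.Om (s.1.i x) := by
      change St.Om (Finsupp.lsum ℝ _ z) = _
      rw [Finsupp.lsum_apply, Finsupp.sum, map_sum, Finsupp.sum]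
    rw [e, e2, e3, Finsupp.sum, Finsupp.sum, Finsupp.sum, ← Finset.sum_sub_distrib]
    refine (add_le_add_left (norm_sum_le _ _) _).trans ?_
    rw [← Finset.sum_add_distrib]
    exact Finset.sum_le_sum fun s _ => s.1.hc _
  have hO : ∀ x, ‖O x‖ ≤ ‖x‖ := by
    intro x
    obtain ⟨⟨u, x⟩, rfl⟩ := (SN.of N).surjective x
    change M (St.Om u, Tb x) ≤ N (u, x)
    refine le_amalg _ _ _ _ _ fun z => ?_
    refine (amalg_le _ _ _ _ (Tb z)).trans ?_
    change ‖St.Om u + jb (Tb z)‖ + qb (Tb x - Tb z) + vb (Tb z) ≤ ‖u + ib z‖ + pb (x - z) + wb z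
    have b1 := hT1 (x - z)
    rw [map_sub] at b1
    have b2 := hT2 z
    have b3 := St.hOm (u + ib z)
    have b4 : ‖St.Om u + jb (Tb z)‖ ≤ ‖St.Om (u + ib z)‖ + ‖St.Om (ib z) - jb (Tb z)‖ := by
      have : St.Om u + jb (Tb z) = St.Om (u + ib z) - (St.Om (ib z) - jb (Tb z)) := by
        rw [map_add]; abel
      rw [this]; exact norm_sub_le _ _
    linarith
  refine ⟨⟨SN N, SN M, O, hO, sep_amalg _ _ _ fun s => s.1.cp, sep_amalg _ _ _ fun s => s.1.cq⟩,
    ⟨(SN.of N).toLinearMap ∘ₗ LinearMap.inl ℝ _ _, hNl⟩,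
    ⟨(SN.of M).toLinearMap ∘ₗ LinearMap.inl ℝ _ _, hMl⟩, ?_, ?_⟩
  · intro u
    change SN.of M (St.Om u, Tb 0) = SN.of M (St.Om u, 0)
    rw [map_zero]
  · intro P η hη
    obtain ⟨P', hP', ei, ep, ew, ej, eq, ev⟩ := hd P (η / 2) (half_pos hη)
    let s : S := ⟨P', hP'⟩
    let i' : X →ₗ[ℝ] SN N := (SN.of N).toLinearMap ∘ₗ LinearMap.inr ℝ St.U (S →₀ X) ∘ₗ
      Finsupp.lsingle s
    let j' : Y →ₗ[ℝ] SN M := (SN.of M).toLinearMap ∘ₗ LinearMap.inr ℝ St.V (S →₀ Y) ∘ₗ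
      Finsupp.lsingle s
    have ni : ∀ z, ‖i' z‖ = P'.p z := fun z => hNr s z
    have nj : ∀ z, ‖j' z‖ = P'.q z := fun z => hMr s z
    have di : ∀ z, ‖i' z - SN.of N (P.i z, 0)‖ ≤ P.w z + η * ‖z‖ := by
      intro z
      have e : i' z - SN.of N (P.i z, 0) = SN.of N (-(ib (Finsupp.single s z)),
          Finsupp.single s z) + SN.of N (P'.i z - P.i z, 0) := by
        change SN.of N (0, Finsupp.single s z) - _ = _
        rw [← map_sub, ← map_add]
        congr 1
        have : ib (Finsupp.single s z) = P'.i z := by simp [ib, s]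
        rw [this]
        simp
        abel
      rw [e]
      refine (norm_add_le _ _).trans ?_
      rw [SN.norm_of, SN.norm_of, hNl]
      have c1 : N (-(ib (Finsupp.single s z)), Finsupp.single s z) ≤ P'.w z :=
        (amalg_diff_le pb wb ib _).trans (sumSem_single _ s z).le
      have c2 := ei z
      have c3 := abs_le.1 (ew z)
      linarith
    have dj : ∀ z, ‖j' z - SN.of M (P.j z, 0)‖ ≤ P.v z + η * ‖z‖ := by
      intro z
      have e : j' z - SN.of M (P.j z, 0) = SN.of M (-(jb (Finsupp.single s z)),
          Finsupp.single s z) + SN.of M (P'.j z - P.j z, 0) := by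
        change SN.of M (0, Finsupp.single s z) - _ = _
        rw [← map_sub, ← map_add]
        congr 1
        have : jb (Finsupp.single s z) = P'.j z := by simp [jb, s]
        rw [this]
        simp
        abel
      rw [e]
      refine (norm_add_le _ _).trans ?_
      rw [SN.norm_of, SN.norm_of, hMl]
      have c1 : M (-(jb (Finsupp.single s z)), Finsupp.single s z) ≤ P'.v z :=
        (amalg_diff_le qb vb jb _).trans (sumSem_single _ s z).le
      have c2 := ej z
      have c3 := abs_le.1 (ev z)
      linarith
    refine ⟨i', j', ?_, ?_, di, ?_, ?_, dj, ?_⟩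
    · intro z
      have := abs_le.1 (ep z)
      have h0 := norm_nonneg z
      have : ‖i' z‖ ≤ P.p z + η * ‖z‖ := by rw [ni]; nlinarith
      exact this
    · intro z
      have := abs_le.1 (ep z)
      have h0 := norm_nonneg z
      have : P.p z ≤ ‖i' z‖ + η * ‖z‖ := by rw [ni]; nlinarith
      exact this
    · intro z
      have := abs_le.1 (eq z)
      have h0 := norm_nonneg z
      have : ‖j' z‖ ≤ P.q z + η * ‖z‖ := by rw [nj]; nlinarith
      exact this
    · intro z
      have := abs_le.1 (eq z)
      have h0 := norm_nonneg z
      have : P.q z ≤ ‖j' z‖ + η * ‖z‖ := by rw [nj]; nlinarith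
      exact this
    · intro z
      change SN.of M (St.Om 0, Tb (Finsupp.single s z)) = SN.of M (0, Finsupp.single s (T z))
      simp [Tb]

section limit
variable (U : ℕ → Type) [∀ n, SeminormedAddCommGroup (U n)] [∀ n, NormedSpace ℝ (U n)]
  (f : ∀ n, U n →ₗᵢ[ℝ] U (n + 1))

/-- sequences compatible from `N` on -/
def compat (N : ℕ) : Submodule ℝ (∀ n, U n) where
  carrier := {x | ∀ n ≥ N, f n (x n) = x (n + 1)}
  zero_mem' := by intro n _; simp
  add_mem' := by
    intro x y hx hy n hn
    simp [hx n hn, hy n hn]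
  smul_mem' := by
    intro r x hx n hn
    simp [hx n hn]

theorem compat_mono {N M : ℕ} (h : N ≤ M) : compat U f N ≤ compat U f M :=
  fun _ hx n hn => hx n (h.trans hn)

/-- eventually compatible sequences -/
def limSub : Submodule ℝ (∀ n, U n) where
  carrier := {x | ∃ N, x ∈ compat U f N}
  zero_mem' := ⟨0, Submodule.zero_mem _⟩
  add_mem' := by
    rintro x y ⟨N, hx⟩ ⟨M, hy⟩
    exact ⟨max N M, Submodule.add_mem _ (compat_mono U f (le_max_left _ _) hx)
      (compat_mono U f (le_max_right _ _) hy)⟩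
  smul_mem' := by
    rintro r x ⟨N, hx⟩
    exact ⟨N, Submodule.smul_mem _ _ hx⟩

theorem compat_norm {N : ℕ} {x : ∀ n, U n} (hx : x ∈ compat U f N) (n : ℕ) (hn : N ≤ n) :
    ‖x n‖ = ‖x N‖ := by
  induction n, hn using Nat.le_induction with
  | base => rfl
  | succ n hn ih => rw [← hx n hn, LinearIsometry.norm_map, ih]

/-- limit norm -/
noncomputable def limVal (x : limSub U f) : ℝ := ‖x.1 (Classical.choose x.2)‖

theorem limVal_eq (x : limSub U f) {N : ℕ} (hx : x.1 ∈ compat U f N) (n : ℕ) (hn : N ≤ n) :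
    limVal U f x = ‖x.1 n‖ := by
  have h0 := Classical.choose_spec x.2
  rw [limVal, ← compat_norm U f h0 (max n (Classical.choose x.2)) (le_max_right _ _),
    compat_norm U f hx n hn, compat_norm U f hx _ (hn.trans (le_max_left _ _))]

/-- limit seminorm -/
noncomputable def limSem : Seminorm ℝ (limSub U f) :=
  Seminorm.ofSMulLE (limVal U f)
    (by rw [limVal_eq U f 0 (N := 0) (Submodule.zero_mem _) 0 le_rfl]; simp)
    (by
      intro x y
      obtain ⟨N, hx⟩ := x.2
      obtain ⟨M, hy⟩ := y.2
      have hx := compat_mono U f (le_max_left N M) hx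
      have hy := compat_mono U f (le_max_right N M) hy
      rw [limVal_eq U f x hx _ le_rfl, limVal_eq U f y hy _ le_rfl,
        limVal_eq U f (x + y) (Submodule.add_mem _ hx hy) _ le_rfl]
      exact norm_add_le _ _)
    (by
      intro r x
      obtain ⟨N, hx⟩ := x.2
      rw [limVal_eq U f x hx _ le_rfl,
        limVal_eq U f (r • x) (Submodule.smul_mem _ r hx) _ le_rfl]
      exact norm_smul_le _ _)

theorem limSem_eq (x : limSub U f) {N : ℕ} (hx : x.1 ∈ compat U f N) (n : ℕ) (hn : N ≤ n) :
    limSem U f x = ‖x.1 n‖ := limVal_eq U f x hx n hn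

/-- transition maps -/
noncomputable def trans (n k : ℕ) (h : n ≤ k) : U n →ₗ[ℝ] U k :=
  Nat.leRecOn (C := fun k => U n →ₗ[ℝ] U k) h (fun {k} g => (f k).toLinearMap ∘ₗ g) LinearMap.id

theorem trans_self (n : ℕ) (u : U n) : trans U f n n le_rfl u = u := by
  rw [trans, Nat.leRecOn_self]; rfl

theorem trans_succ (n k : ℕ) (h : n ≤ k) (u : U n) :
    trans U f n (k + 1) (h.trans (Nat.le_succ k)) u = f k (trans U f n k h u) := by
  rw [trans, Nat.leRecOn_succ h]; rfl

/-- embedding of the `n`-th space -/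
noncomputable def emb (n : ℕ) : U n →ₗ[ℝ] limSub U f :=
  LinearMap.codRestrict (limSub U f)
    (LinearMap.pi fun k => if h : n ≤ k then trans U f n k h else 0)
    (fun u => ⟨n, fun k hk => by
      simp only [LinearMap.pi_apply]
      rw [dif_pos hk, dif_pos (hk.trans (Nat.le_succ k)), trans_succ]⟩)

theorem emb_apply (n k : ℕ) (h : n ≤ k) (u : U n) : (emb U f n u).1 k = trans U f n k h u := by
  change (if h : n ≤ k then trans U f n k h else 0 : U n →ₗ[ℝ] U k) u = _
  rw [dif_pos h]

theorem emb_apply_not (n k : ℕ) (h : ¬ n ≤ k) (u : U n) : (emb U f n u).1 k = 0 := by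
  change (if h : n ≤ k then trans U f n k h else 0 : U n →ₗ[ℝ] U k) u = _
  rw [dif_neg h]; rfl

theorem emb_self (n : ℕ) (u : U n) : (emb U f n u).1 n = u := by
  rw [emb_apply U f n n le_rfl, trans_self]

theorem emb_compat (n : ℕ) (u : U n) : (emb U f n u).1 ∈ compat U f n := by
  intro k hk
  rw [emb_apply U f n k hk, emb_apply U f n (k + 1) (hk.trans (Nat.le_succ k)), trans_succ]

theorem emb_norm (n : ℕ) (u : U n) : limSem U f (emb U f n u) = ‖u‖ := by
  rw [limSem_eq U f _ (emb_compat U f n u) n le_rfl, emb_self]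

theorem emb_sub (x : limSub U f) {N : ℕ} (hx : x.1 ∈ compat U f N) :
    limSem U f (emb U f N (x.1 N) - x) = 0 := by
  rw [limSem_eq U f _ (Submodule.sub_mem _ (emb_compat U f N _) hx) N le_rfl]
  simp [emb_self]

theorem lim_sep [∀ n, SeparableSpace (U n)] : SeparableSpace (SN (limSem U f)) := by
  have c : ∀ n, Continuous fun u : U n => SN.of (limSem U f) (emb U f n u) := by
    intro n
    let g : U n →ₗ[ℝ] SN (limSem U f) := (SN.of (limSem U f)).toLinearMap ∘ₗ emb U f n
    refine (g.mkContinuous 1 fun u => ?_).continuous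
    rw [one_mul]
    exact (emb_norm U f n u).le
  have hs : IsSeparable (⋃ n, Set.range fun u : U n => SN.of (limSem U f) (emb U f n u)) :=
    IsSeparable.iUnion fun n => isSeparable_range (c n)
  rw [← isSeparable_univ_iff]
  refine hs.closure.mono fun y _ => ?_
  obtain ⟨x, rfl⟩ := (SN.of (limSem U f)).surjective y
  obtain ⟨N, hx⟩ := x.2
  rw [Metric.mem_closure_iff]
  intro ε hε
  refine ⟨_, Set.mem_iUnion.2 ⟨N, x.1 N, rfl⟩, ?_⟩
  rw [dist_comm, dist_eq_norm, ← map_sub, SN.norm_of, emb_sub U f x hx]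
  exact hε

theorem compat_range {X : Type} [AddCommGroup X] [Module ℝ X] [FiniteDimensional ℝ X]
    (i : X →ₗ[ℝ] limSub U f) : ∃ N, ∀ z, (i z).1 ∈ compat U f N := by
  let b := Module.finBasis ℝ X
  choose N hN using fun k => (i (b k)).2
  refine ⟨Finset.univ.sup N, fun z => ?_⟩
  rw [← b.sum_repr z, map_sum, AddSubmonoidClass.coe_finsetSum]
  refine Submodule.sum_mem _ fun k _ => ?_
  rw [map_smul]
  exact Submodule.smul_mem _ _ (compat_mono U f (Finset.le_sup (Finset.mem_univ k)) (hN k))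

end limit

abbrev Idx := ℕ × ℕ × ℕ
abbrev XX (k : Idx) : Type := (Fin k.1 → ℝ) × (Fin k.2.1 → ℝ)
abbrev YY (k : Idx) : Type := (Fin k.2.1 → ℝ) × (Fin k.2.2 → ℝ)
/-- normal form of a linear operator -/
def TT (k : Idx) : XX k →ₗ[ℝ] YY k := LinearMap.inl ℝ _ _ ∘ₗ LinearMap.snd ℝ _ _

theorem exists_chain : ∃ st : ℕ → Stage,
    ∀ n, Good (TT (Denumerable.ofNat Idx n.unpair.1)) (st n) (st (n + 1)) := by
  choose step hstep using fun (k : Idx) (S : Stage) => exists_step (TT k) S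
  refine ⟨fun n => Nat.rec ⟨PUnit, PUnit, 0, by simp, inferInstance, inferInstance⟩
    (fun n S => step (Denumerable.ofNat Idx n.unpair.1) S) n, fun n => hstep _ _⟩

/-- the limit stage -/
theorem exists_limit : ∃ L : Stage, ∀ (k : Idx) (P : Prob L.Om (TT k)), ∀ η > 0, ∃ i' j',
    IsSol L.Om id id P η i' j' := by
  obtain ⟨st, hst⟩ := exists_chain
  choose f g hc hsol using hst
  let U := fun n => (st n).U
  let V := fun n => (st n).V
  let LU := limSub U f
  let LV := limSub V g
  let N := limSem U f
  let M := limSem V g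
  have hmem : ∀ n (x : ∀ n, U n), x ∈ compat U f n →
      (fun n => (st n).Om (x n)) ∈ compat V g n := by
    intro n x hx k hk
    rw [← hc, hx k hk]
  let O0 : LU →ₗ[ℝ] LV :=
    { toFun := fun x => ⟨fun n => (st n).Om (x.1 n), by
        obtain ⟨n, hn⟩ := x.2
        exact ⟨n, hmem n _ hn⟩⟩
      map_add' := by
        intro x y; ext n; simp
      map_smul' := by
        intro r x; ext n; simp }
  let O : SN N →ₗ[ℝ] SN M := (SN.of M).toLinearMap ∘ₗ O0 ∘ₗ (SN.of N).symm.toLinearMap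
  have hO : ∀ x, ‖O x‖ ≤ ‖x‖ := by
    intro x
    obtain ⟨x, rfl⟩ := (SN.of N).surjective x
    obtain ⟨n, hn⟩ := x.2
    change M (O0 x) ≤ N x
    rw [limSem_eq V g (O0 x) (hmem n _ hn) n le_rfl, limSem_eq U f x hn n le_rfl]
    exact (st n).hOm _
  have hemb : ∀ n (u : U n), O0 (emb U f n u) = emb V g n ((st n).Om u) := by
    intro n u
    ext k
    change (st k).Om ((emb U f n u).1 k) = _
    by_cases h : n ≤ k
    · rw [emb_apply U f n k h, emb_apply V g n k h]
      induction k, h using Nat.le_induction with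
      | base => rw [trans_self, trans_self]
      | succ k h ih => rw [trans_succ U f n k h, trans_succ V g n k h, hc, ih]
    · rw [emb_apply_not U f n k h, emb_apply_not V g n k h, map_zero]
  refine ⟨⟨SN N, SN M, O, hO, lim_sep U f, lim_sep V g⟩, ?_⟩
  intro k P η hη
  let i0 : XX k →ₗ[ℝ] LU := (SN.of N).symm.toLinearMap ∘ₗ P.i
  let j0 : YY k →ₗ[ℝ] LV := (SN.of M).symm.toLinearMap ∘ₗ P.j
  obtain ⟨N1, hN1⟩ := compat_range U f i0
  obtain ⟨N2, hN2⟩ := compat_range V g j0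
  obtain ⟨n, hn1, hn2, hk⟩ : ∃ n, N1 ≤ n ∧ N2 ≤ n ∧ Denumerable.ofNat Idx n.unpair.1 = k := by
    refine ⟨Nat.pair (Encodable.encode k) (max N1 N2), ?_, ?_, ?_⟩
    · exact (le_max_left _ _).trans (Nat.right_le_pair _ _)
    · exact (le_max_right _ _).trans (Nat.right_le_pair _ _)
    · rw [Nat.unpair_pair]; exact Denumerable.ofNat_encode k
  have hs : ∀ k', Denumerable.ofNat Idx n.unpair.1 = k' → ∀ P : Prob (st n).Om (TT k'), ∀ η > 0,
      ∃ i' j', IsSol (st (n + 1)).Om (f n) (g n) P η i' j' := by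
    rintro _ rfl; exact hsol n
  have hX : ∀ z, (i0 z).1 ∈ compat U f n := fun z => compat_mono U f hn1 (hN1 z)
  have hY : ∀ z, (j0 z).1 ∈ compat V g n := fun z => compat_mono V g hn2 (hN2 z)
  have nX : ∀ z, ‖(i0 z).1 n‖ = ‖P.i z‖ := fun z => (limSem_eq U f (i0 z) (hX z) n le_rfl).symm
  have nY : ∀ z, ‖(j0 z).1 n‖ = ‖P.j z‖ := fun z => (limSem_eq V g (j0 z) (hY z) n le_rfl).symm
  have nXY : ∀ z, ‖(st n).Om ((i0 z).1 n) - (j0 (TT k z)).1 n‖ = ‖O (P.i z) - P.j (TT k z)‖ :=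
    fun z => (limSem_eq V g (O0 (i0 z) - j0 (TT k z))
      (Submodule.sub_mem _ (hmem n _ (hX z)) (hY _)) n le_rfl).symm
  let P' : Prob (st n).Om (TT k) :=
    { i := LinearMap.proj n ∘ₗ LU.subtype ∘ₗ i0
      j := LinearMap.proj n ∘ₗ LV.subtype ∘ₗ j0
      p := P.p
      w := P.w
      q := P.q
      v := P.v
      cp := P.cp
      cw := P.cw
      cq := P.cq
      cv := P.cv
      hi1 := fun z => (nX z).le.trans (P.hi1 z)
      hi2 := fun z => (P.hi2 z).trans (add_le_add_left (nX z).ge _)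
      hj1 := fun z => (nY z).le.trans (P.hj1 z)
      hj2 := fun z => (P.hj2 z).trans (add_le_add_left (nY z).ge _)
      hT := P.hT
      hc := fun z => (add_le_add_left (nXY z).le _).trans (P.hc z) }
  obtain ⟨i', j', h⟩ := hs k hk P' η hη
  refine ⟨(SN.of N).toLinearMap ∘ₗ emb U f (n + 1) ∘ₗ i',
    (SN.of M).toLinearMap ∘ₗ emb V g (n + 1) ∘ₗ j', ?_, ?_, ?_, ?_, ?_, ?_, ?_⟩
  · intro z
    exact (emb_norm U f (n + 1) (i' z)).le.trans (h.i1 z)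
  · intro z
    exact (h.i2 z).trans (add_le_add_left (emb_norm U f (n + 1) (i' z)).ge _)
  · intro z
    have e : N (emb U f (n + 1) (i' z) - i0 z) = ‖i' z - f n ((i0 z).1 n)‖ := by
      rw [limSem_eq U f _ (Submodule.sub_mem _ (emb_compat U f (n + 1) _)
        (compat_mono U f (Nat.le_succ n) (hX z))) (n + 1) le_rfl, hX z n le_rfl]
      change ‖(emb U f (n + 1) (i' z)).1 (n + 1) - _‖ = _
      rw [emb_self]
    exact e.le.trans (h.i3 z)
  · intro z
    exact (emb_norm V g (n + 1) (j' z)).le.trans (h.j1 z)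
  · intro z
    exact (h.j2 z).trans (add_le_add_left (emb_norm V g (n + 1) (j' z)).ge _)
  · intro z
    have e : M (emb V g (n + 1) (j' z) - j0 z) = ‖j' z - g n ((j0 z).1 n)‖ := by
      rw [limSem_eq V g _ (Submodule.sub_mem _ (emb_compat V g (n + 1) _)
        (compat_mono V g (Nat.le_succ n) (hY z))) (n + 1) le_rfl, hY z n le_rfl]
      change ‖(emb V g (n + 1) (j' z)).1 (n + 1) - _‖ = _
      rw [emb_self]
    exact e.le.trans (h.j3 z)
  · intro z
    change SN.of M (O0 (emb U f (n + 1) (i' z))) = SN.of M (emb V g (n + 1) (j' (TT k z)))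
    rw [hemb, h.comm]

theorem normal_form {X Y : Type} [AddCommGroup X] [Module ℝ X] [FiniteDimensional ℝ X]
    [AddCommGroup Y] [Module ℝ Y] [FiniteDimensional ℝ Y] (T : X →ₗ[ℝ] Y) :
    ∃ (k : Idx) (e : X ≃ₗ[ℝ] XX k) (g : Y ≃ₗ[ℝ] YY k), ∀ x, g (T x) = TT k (e x) := by
  obtain ⟨C, hC⟩ := Submodule.exists_isCompl (LinearMap.ker T)
  obtain ⟨D, hD⟩ := Submodule.exists_isCompl (LinearMap.range T)
  let eK := (Module.finBasis ℝ (LinearMap.ker T)).equivFun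
  let eR := (Module.finBasis ℝ (LinearMap.range T)).equivFun
  let eD := (Module.finBasis ℝ D).equivFun
  let eC := (Submodule.quotientEquivOfIsCompl _ _ hC).symm ≪≫ₗ T.quotKerEquivRange
  have hC' : ∀ c : C, eC c = ⟨T c, ⟨c, rfl⟩⟩ := by
    intro c
    ext
    simp [eC]
  refine ⟨(_, _, _), (Submodule.prodEquivOfIsCompl _ _ hC).symm ≪≫ₗ
    LinearEquiv.prodCongr eK (eC ≪≫ₗ eR),
    (Submodule.prodEquivOfIsCompl _ _ hD).symm ≪≫ₗ LinearEquiv.prodCongr eR eD, fun x => ?_⟩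
  obtain ⟨⟨a, c⟩, rfl⟩ := (Submodule.prodEquivOfIsCompl _ _ hC).surjective x
  have h1 : T ((Submodule.prodEquivOfIsCompl _ _ hC) (a, c)) = (eC c : Y) := by
    rw [hC']; simp
  rw [h1]
  simp only [LinearEquiv.trans_apply, LinearEquiv.symm_apply_apply,
    Submodule.prodEquivOfIsCompl_symm_apply_left]
  simp [TT]
  change (eR (eC c), eD 0) = (eR (eC c), 0)
  rw [map_zero]

theorem ext_general {X Y : Type} [NormedAddCommGroup X] [NormedSpace ℝ X] [FiniteDimensional ℝ X]
    [NormedAddCommGroup Y] [NormedSpace ℝ Y] [FiniteDimensional ℝ Y] (T : X →ₗ[ℝ] Y)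
    (L : Stage) (hL : ∀ (k : Idx) (P : Prob L.Om (TT k)), ∀ η > 0, ∃ i' j',
      IsSol L.Om id id P η i' j') (P : Prob L.Om T) (η : ℝ) (hη : 0 < η) :
    ∃ i' j', IsSol L.Om id id P η i' j' := by
  obtain ⟨k, e, g, h⟩ := normal_form T
  have h' : ∀ z, g.symm (TT k z) = T (e.symm z) := by
    intro z
    rw [LinearEquiv.symm_apply_eq, h, LinearEquiv.apply_symm_apply]
  have ce : Continuous e.symm := e.symm.toLinearMap.continuous_of_finiteDimensional
  have cg : Continuous g.symm := g.symm.toLinearMap.continuous_of_finiteDimensional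
  let P' : Prob L.Om (TT k) :=
    { i := P.i ∘ₗ e.symm.toLinearMap
      j := P.j ∘ₗ g.symm.toLinearMap
      p := P.p.comp e.symm.toLinearMap
      w := P.w.comp e.symm.toLinearMap
      q := P.q.comp g.symm.toLinearMap
      v := P.v.comp g.symm.toLinearMap
      cp := P.cp.comp ce
      cw := P.cw.comp ce
      cq := P.cq.comp cg
      cv := P.cv.comp cg
      hi1 := fun z => P.hi1 _
      hi2 := fun z => P.hi2 _
      hj1 := fun z => P.hj1 _
      hj2 := fun z => P.hj2 _
      hT := fun z => by
        simp only [Seminorm.comp_apply, LinearEquiv.coe_coe, h']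
        exact P.hT _
      hc := fun z => by
        simp only [Seminorm.comp_apply, LinearEquiv.coe_coe, LinearMap.comp_apply, h']
        exact P.hc _ }
  let e1 := LinearMap.toContinuousLinearMap e.toLinearMap
  let g1 := LinearMap.toContinuousLinearMap g.toLinearMap
  let C := ‖e1‖ + ‖g1‖ + 1
  have hCpos : 0 < C := by positivity
  have be : ∀ z, η / C * ‖e z‖ ≤ η * ‖z‖ := by
    intro z
    have h1 : ‖e z‖ ≤ ‖e1‖ * ‖z‖ := e1.le_opNorm z
    have h2 : ‖e1‖ * ‖z‖ ≤ C * ‖z‖ := by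
      gcongr
      have := norm_nonneg g1
      simp only [C]; linarith
    calc η / C * ‖e z‖ ≤ η / C * (C * ‖z‖) := by gcongr; exact h1.trans h2
      _ = η * ‖z‖ := by field_simp
  have bg : ∀ z, η / C * ‖g z‖ ≤ η * ‖z‖ := by
    intro z
    have h1 : ‖g z‖ ≤ ‖g1‖ * ‖z‖ := g1.le_opNorm z
    have h2 : ‖g1‖ * ‖z‖ ≤ C * ‖z‖ := by
      gcongr
      have := norm_nonneg e1
      simp only [C]; linarith
    calc η / C * ‖g z‖ ≤ η / C * (C * ‖z‖) := by gcongr; exact h1.trans h2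
      _ = η * ‖z‖ := by field_simp
  obtain ⟨i', j', s⟩ := hL k P' (η / C) (by positivity)
  refine ⟨i' ∘ₗ e.toLinearMap, j' ∘ₗ g.toLinearMap, ?_, ?_, ?_, ?_, ?_, ?_, ?_⟩
  · intro z
    have := s.i1 (e z); have := be z
    simp only [P', Seminorm.comp_apply, LinearEquiv.coe_coe, LinearMap.comp_apply,
      LinearEquiv.symm_apply_apply] at *
    linarith
  · intro z
    have := s.i2 (e z); have := be z
    simp only [P', Seminorm.comp_apply, LinearEquiv.coe_coe, LinearMap.comp_apply,
      LinearEquiv.symm_apply_apply] at *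
    linarith
  · intro z
    have := s.i3 (e z); have := be z
    simp only [P', Seminorm.comp_apply, LinearEquiv.coe_coe, LinearMap.comp_apply,
      LinearEquiv.symm_apply_apply] at *
    linarith
  · intro z
    have := s.j1 (g z); have := bg z
    simp only [P', Seminorm.comp_apply, LinearEquiv.coe_coe, LinearMap.comp_apply,
      LinearEquiv.symm_apply_apply] at *
    linarith
  · intro z
    have := s.j2 (g z); have := bg z
    simp only [P', Seminorm.comp_apply, LinearEquiv.coe_coe, LinearMap.comp_apply,
      LinearEquiv.symm_apply_apply] at *
    linarith
  · intro z
    have := s.j3 (g z); have := bg z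
    simp only [P', Seminorm.comp_apply, LinearEquiv.coe_coe, LinearMap.comp_apply,
      LinearEquiv.symm_apply_apply] at *
    linarith
  · intro z
    have := s.comm (e z)
    simp only [LinearEquiv.coe_coe, LinearMap.comp_apply]
    rw [this, h]

open UniformSpace (Completion)

theorem approx {X L : Type} [NormedAddCommGroup X] [NormedSpace ℝ X] [FiniteDimensional ℝ X]
    [SeminormedAddCommGroup L] [NormedSpace ℝ L] (f : X →ₗ[ℝ] Completion L) (δ : ℝ) (hδ : 0 < δ) :
    ∃ f1 : X →ₗ[ℝ] L, ∀ z, ‖((f1 z : L) : Completion L) - f z‖ ≤ δ * ‖z‖ := by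
  let b := Module.finBasis ℝ X
  obtain ⟨C, hC, hb⟩ := b.exists_opNorm_le (F := Completion L)
  have hd : ∀ k, ∃ u : L, ‖(u : Completion L) - f (b k)‖ ≤ δ / C := by
    intro k
    obtain ⟨u, hy⟩ := (Completion.denseRange_coe (α := L)).exists_dist_lt (f (b k))
      (show 0 < δ / C by positivity)
    exact ⟨u, by rw [← dist_eq_norm, dist_comm]; exact hy.le⟩
  choose u hu using hd
  let f1 : X →ₗ[ℝ] L := b.constr ℝ u
  let D : X →ₗ[ℝ] Completion L := (Completion.toComplₗᵢ (𝕜 := ℝ) (E := L)).toLinearMap ∘ₗ f1 - f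
  have h1 := hb (u := LinearMap.toContinuousLinearMap D) (M := δ / C) (by positivity) (by
    intro k
    have : D (b k) = (u k : Completion L) - f (b k) := by
      change ((f1 (b k) : L) : Completion L) - _ = _
      simp [f1]
    change ‖D (b k)‖ ≤ _
    rw [this]; exact hu k)
  refine ⟨f1, fun z => ?_⟩
  have h2 := (LinearMap.toContinuousLinearMap D).le_opNorm z
  have h3 : C * (δ / C) = δ := by field_simp
  rw [h3] at h1
  exact h2.trans (by gcongr)

theorem gurarii_star (L : Stage) (hL : ∀ (k : Idx) (P : Prob L.Om (TT k)), ∀ η > 0, ∃ i' j',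
      IsSol L.Om id id P η i' j') (F : Completion L.U →L[ℝ] Completion L.V)
      (hF : ∀ u : L.U, F u = (L.Om u : L.V)) (hF1 : ‖F‖ ≤ 1) : HasGurariiStarProperty F := by
  intro ε hε X Y _ _ _ _ _ _ X₀ Y₀ T hT1 hT i j hij
  obtain ⟨P0, hP0⟩ := LinearMap.exists_leftInverse_of_injective X₀.subtype X₀.ker_subtype
  obtain ⟨Q0, hQ0⟩ := LinearMap.exists_leftInverse_of_injective Y₀.subtype Y₀.ker_subtype
  have hP : ∀ x : X₀, P0 x = x := fun x => LinearMap.congr_fun hP0 x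
  have hQ : ∀ x : Y₀, Q0 x = x := fun x => LinearMap.congr_fun hQ0 x
  have hTn : ∀ z, ‖T z‖ ≤ ‖z‖ := fun z => by
    simpa using T.le_of_opNorm_le hT1 z
  have hFn : ∀ z, ‖F z‖ ≤ ‖z‖ := fun z => by
    simpa using F.le_of_opNorm_le hF1 z
  let η := ε / (14 + 7 * ε)
  have hη : 0 < η := by positivity
  have hη1 : η * (14 + 7 * ε) = ε := by simp only [η]; field_simp
  obtain ⟨i1, hi1⟩ := approx (i.toLinearMap ∘ₗ P0) η hη
  obtain ⟨j1, hj1⟩ := approx (j.toLinearMap ∘ₗ Q0) η hη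
  let Q1 := LinearMap.toContinuousLinearMap Q0
  let K := ‖Q1‖
  have hK : 0 ≤ K := norm_nonneg Q1
  have hQn : ∀ y, ‖Q0 y‖ ≤ K * ‖y‖ := fun y => Q1.le_opNorm y
  let RX : X →ₗ[ℝ] X := LinearMap.id - X₀.subtype ∘ₗ P0
  let RY : Y →ₗ[ℝ] Y := LinearMap.id - Y₀.subtype ∘ₗ Q0
  have hRX : ∀ z, RX z = z - P0 z := fun z => rfl
  have hRY : ∀ z, RY z = z - Q0 z := fun z => rfl
  have cRX : Continuous RX := RX.continuous_of_finiteDimensional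
  have cRY : Continuous RY := RY.continuous_of_finiteDimensional
  let c1 : NNReal := ⟨1 + 2 * K, by positivity⟩
  let c2 : NNReal := ⟨3 * η, by positivity⟩
  let c3 : NNReal := ⟨η, hη.le⟩
  let w : Seminorm ℝ X := c1 • (normSeminorm ℝ X).comp RX + c2 • normSeminorm ℝ X
  let v : Seminorm ℝ Y := (normSeminorm ℝ Y).comp RY + c3 • normSeminorm ℝ Y
  have hw : ∀ z, w z = (1 + 2 * K) * ‖RX z‖ + 3 * η * ‖z‖ := fun z => rfl
  have hv : ∀ z, v z = ‖RY z‖ + η * ‖z‖ := fun z => rfl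
  have cw : Continuous w := by
    have : (w : X → ℝ) = fun z => (1 + 2 * K) * ‖RX z‖ + 3 * η * ‖z‖ := rfl
    rw [this]; fun_prop
  have cv : Continuous v := by
    have : (v : Y → ℝ) = fun z => ‖RY z‖ + η * ‖z‖ := rfl
    rw [this]; fun_prop
  -- norm comparisons
  have ni : ∀ z, |‖i1 z‖ - ‖z‖| ≤ η * ‖z‖ + ‖RX z‖ := by
    intro z
    have a1 := (abs_norm_sub_norm_le _ _).trans (hi1 z)
    have a2 : ‖(i.toLinearMap ∘ₗ P0) z‖ = ‖(P0 z : X)‖ := i.norm_map (P0 z)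
    rw [Completion.norm_coe, a2] at a1
    have a3 : |‖z‖ - ‖(P0 z : X)‖| ≤ ‖RX z‖ := abs_norm_sub_norm_le z (P0 z : X)
    rw [abs_le] at *
    constructor <;> linarith
  have nj : ∀ z, |‖j1 z‖ - ‖z‖| ≤ η * ‖z‖ + ‖RY z‖ := by
    intro z
    have a1 := (abs_norm_sub_norm_le _ _).trans (hj1 z)
    have a2 : ‖(j.toLinearMap ∘ₗ Q0) z‖ = ‖(Q0 z : Y)‖ := j.norm_map (Q0 z)
    rw [Completion.norm_coe, a2] at a1
    have a3 : |‖z‖ - ‖(Q0 z : Y)‖| ≤ ‖RY z‖ := abs_norm_sub_norm_le z (Q0 z : Y)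
    rw [abs_le] at *
    constructor <;> linarith
  have cross : ∀ z, ‖L.Om (i1 z) - j1 (T z)‖ ≤ 2 * η * ‖z‖ + K * ‖RX z‖ := by
    intro z
    have e1 : F (i (P0 z)) - j (Q0 (T z)) = -j (Q0 (T (RX z))) := by
      have : Q0 (T (RX z)) = Q0 (T z) - ⟨T (P0 z), hT _ (P0 z).2⟩ := by
        rw [hRX, map_sub, map_sub]
        congr 1
        exact hQ ⟨T (P0 z), hT _ (P0 z).2⟩
      rw [hij, this, map_sub]; abel
    have e2 : ((L.Om (i1 z) - j1 (T z) : L.V) : Completion L.V) =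
        F ((i1 z : L.U) - i (P0 z)) - ((j1 (T z) : L.V) - j (Q0 (T z))) +
          (F (i (P0 z)) - j (Q0 (T z))) := by
      rw [map_sub, hF, Completion.coe_sub]; abel
    rw [← Completion.norm_coe, e2, e1]
    have b1 := (hFn ((i1 z : L.U) - i (P0 z))).trans (hi1 z)
    have b2 : ‖((j1 (T z) : L.V) : Completion L.V) - j (Q0 (T z))‖ ≤ η * ‖z‖ :=
      (hj1 (T z)).trans (by gcongr; exact hTn z)
    have b3 : ‖-j (Q0 (T (RX z)))‖ ≤ K * ‖RX z‖ := by
      rw [norm_neg, j.norm_map]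
      exact (hQn _).trans (mul_le_mul_of_nonneg_left (hTn _) hK)
    have b4 := norm_add_le (F ((i1 z : L.U) - i (P0 z)) -
      (((j1 (T z) : L.V) : Completion L.V) - j (Q0 (T z)))) (-j (Q0 (T (RX z))))
    have b5 := norm_sub_le (F ((i1 z : L.U) - i (P0 z)))
      (((j1 (T z) : L.V) : Completion L.V) - j (Q0 (T z)))
    linarith
  have hRT : ∀ z, ‖RY (T z)‖ ≤ (1 + K) * ‖RX z‖ := by
    intro z
    have e1 : RY (T z) = RY (T (RX z)) := by
      have : RY (T (P0 z)) = 0 := by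
        rw [hRY, hQ ⟨T (P0 z), hT _ (P0 z).2⟩, sub_self]
      rw [hRX, map_sub, map_sub, this, sub_zero]
    rw [e1, hRY]
    have b1 := norm_sub_le (T (RX z)) (Q0 (T (RX z)) : Y)
    have b2 := hTn (RX z)
    have b3 : ‖(Q0 (T (RX z)) : Y)‖ ≤ K * ‖RX z‖ :=
      (hQn _).trans (mul_le_mul_of_nonneg_left (hTn _) hK)
    linarith
  let Pr : Prob L.Om (T : X →ₗ[ℝ] Y) :=
    { i := i1
      j := j1
      p := normSeminorm ℝ X
      w := w
      q := normSeminorm ℝ Y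
      v := v
      cp := continuous_norm
      cw := cw
      cq := continuous_norm
      cv := cv
      hi1 := fun z => by
        have := abs_le.1 (ni z)
        have h1 := mul_nonneg hK (norm_nonneg (RX z))
        have h2 := mul_nonneg hη.le (norm_nonneg z)
        rw [coe_normSeminorm, hw]; linarith
      hi2 := fun z => by
        have := abs_le.1 (ni z)
        have h1 := mul_nonneg hK (norm_nonneg (RX z))
        have h2 := mul_nonneg hη.le (norm_nonneg z)
        rw [coe_normSeminorm, hw]; linarith
      hj1 := fun z => by
        have := abs_le.1 (nj z)
        rw [coe_normSeminorm, hv]; linarith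
      hj2 := fun z => by
        have := abs_le.1 (nj z)
        rw [coe_normSeminorm, hv]; linarith
      hT := hTn
      hc := fun z => by
        have h1 := cross z
        have h2 := hRT z
        have h3 := mul_le_mul_of_nonneg_left (hTn z) hη.le
        have e : v ((T : X →ₗ[ℝ] Y) z) = ‖RY (T z)‖ + η * ‖T z‖ := rfl
        rw [hw, e]
        change ‖L.Om (i1 z) - j1 (T z)‖ + _ ≤ _
        linarith }
  obtain ⟨i2, j2, s⟩ := ext_general (T : X →ₗ[ℝ] Y) L hL Pr η hη
  have key : ∀ {Z W : Type} [NormedAddCommGroup Z] [NormedSpace ℝ Z] [FiniteDimensional ℝ Z]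
      [SeminormedAddCommGroup W] [NormedSpace ℝ W] (Z₀ : Submodule ℝ Z)
      (i : Z₀ →ₗᵢ[ℝ] Completion W) (i2 : Z →ₗ[ℝ] W) (a : Z →ₗ[ℝ] W),
      (∀ z, ‖i2 z‖ ≤ ‖z‖ + η * ‖z‖) → (∀ z, ‖z‖ ≤ ‖i2 z‖ + η * ‖z‖) →
      (∀ z : Z₀, ‖i2 z - a z‖ ≤ 4 * η * ‖z‖) →
      (∀ z : Z₀, ‖((a z : W) : Completion W) - i z‖ ≤ η * ‖z‖) →
      let i' : Z →L[ℝ] Completion W := (1 + η)⁻¹ • LinearMap.toContinuousLinearMap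
        ((Completion.toComplₗᵢ (𝕜 := ℝ) (E := W)).toLinearMap ∘ₗ i2)
      IsEpsIsometry ε i' ∧ ‖i'.comp Z₀.subtypeL - i.toContinuousLinearMap‖ < ε := by
    intro Z W _ _ _ _ _ Z₀ i i2 a h1 h2 h3 h4 i'
    have e : ∀ z, i' z = (1 + η)⁻¹ • ((i2 z : W) : Completion W) := fun z => rfl
    have hp : 0 < 1 + η := by positivity
    have en : ∀ z, ‖i' z‖ = (1 + η)⁻¹ * ‖i2 z‖ := by
      intro z
      rw [e, norm_smul, Completion.norm_coe, Real.norm_of_nonneg (by positivity)]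
    refine ⟨fun z => ⟨?_, ?_⟩, ?_⟩
    · rw [en, inv_mul_le_iff₀ (by positivity), mul_left_comm, le_inv_mul_iff₀ hp]
      have := h2 z
      have h0 := norm_nonneg z
      have h5 : 0 ≤ ‖i2 z‖ - (1 - η) * ‖z‖ := by linarith
      have h6 : 0 ≤ (1 + ε) * (‖i2 z‖ - (1 - η) * ‖z‖) := by positivity
      have h7 : 0 ≤ ((1 + ε) * (1 - η) - (1 + η)) * ‖z‖ := by
        refine mul_nonneg ?_ h0
        nlinarith
      nlinarith
    · rw [en, inv_mul_le_iff₀ hp]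
      have := h1 z
      linarith
    · refine lt_of_le_of_lt (ContinuousLinearMap.opNorm_le_bound _ (M := 6 * η) (by positivity)
        fun z => ?_) (by nlinarith)
      change ‖i' z - i z‖ ≤ 6 * η * ‖z‖
      have e3 : i' z - i z = (i' z - ((i2 z : W) : Completion W)) +
          ((i2 z - a z : W) : Completion W) + (((a z : W) : Completion W) - i z) := by
        rw [Completion.coe_sub]; abel
      have e4 : ‖i' z - ((i2 z : W) : Completion W)‖ ≤ η * ‖z‖ := by
        have : i' z - ((i2 z : W) : Completion W) = ((1 + η)⁻¹ - 1) • ((i2 z : W) : Completion W) := by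
          rw [e, sub_smul, one_smul]
        rw [this, norm_smul, Completion.norm_coe]
        have e5 : (1 + η)⁻¹ - 1 = -(η * (1 + η)⁻¹) := by field_simp; ring
        rw [e5, norm_neg, Real.norm_of_nonneg (by positivity), mul_assoc]
        gcongr
        rw [inv_mul_le_iff₀ hp]
        have := h1 z
        change _ ≤ (1 + η) * ‖(z : Z)‖
        linarith
      rw [e3]
      refine (norm_add₃_le).trans ?_
      rw [Completion.norm_coe]
      have := h3 z
      have := h4 z
      linarith
  have hX := key X₀ i i2 i1 s.i1 s.i2 (fun z => by
      have h1 : ‖i2 z - i1 z‖ ≤ w z + η * ‖(z : X)‖ := s.i3 z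
      have h2 : RX z = 0 := by rw [hRX, hP, sub_self]
      rw [hw, h2, norm_zero] at h1
      change _ ≤ 4 * η * ‖(z : X)‖
      linarith) (fun z => by
      have := hi1 z
      simpa [hP] using this)
  have hY := key Y₀ j j2 j1 s.j1 s.j2 (fun z => by
      have h1 : ‖j2 z - j1 z‖ ≤ v z + η * ‖(z : Y)‖ := s.j3 z
      have h2 : RY z = 0 := by rw [hRY, hQ, sub_self]
      rw [hv, h2, norm_zero] at h1
      change _ ≤ 4 * η * ‖(z : Y)‖
      have := mul_nonneg hη.le (norm_nonneg (z : Y))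
      linarith) (fun z => by
      have := hj1 z
      simpa [hQ] using this)
  refine ⟨_, _, hX.1, hY.1, hX.2, hY.2, ?_⟩
  ext z
  change F ((1 + η)⁻¹ • ((i2 z : L.U) : Completion L.U)) =
    (1 + η)⁻¹ • ((j2 (T z) : L.V) : Completion L.V)
  rw [map_smul, hF, s.comm]
  rfl

end GurariiAux

/-- There exist separable Banach spaces `U, V` and a nonexpansive operator `F : U → V`
satisfying condition (G*); in particular `F` has the Gurarii property (G). -/
theorem exists_operator_with_Gurarii_property :
    ∃ (U V : BanachSpace) (F : U.carrier →L[ℝ] V.carrier),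
      TopologicalSpace.SeparableSpace U.carrier ∧
      TopologicalSpace.SeparableSpace V.carrier ∧
      ‖F‖ ≤ 1 ∧ HasGurariiStarProperty F ∧ HasGurariiProperty F := by
  classical
  obtain ⟨L, hL⟩ := GurariiAux.exists_limit
  let F0 : L.U →L[ℝ] L.V := L.Om.mkContinuous 1 (fun u => by simpa using L.hOm u)
  let F := F0.completion
  have hF : ∀ u : L.U, F u = (L.Om u : L.V) := fun u => F0.completion_apply_coe u
  have hF1 : ‖F‖ ≤ 1 := by
    refine ContinuousLinearMap.opNorm_le_bound _ zero_le_one fun x => ?_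
    rw [one_mul]
    induction x using UniformSpace.Completion.induction_on with
    | hp => exact isClosed_le (by fun_prop) (by fun_prop)
    | ih u =>
      rw [hF, UniformSpace.Completion.norm_coe, UniformSpace.Completion.norm_coe]
      exact L.hOm u
  have hG := GurariiAux.gurarii_star L hL F hF hF1
  refine ⟨⟨UniformSpace.Completion L.U⟩, ⟨UniformSpace.Completion L.V⟩, F, inferInstance,
    inferInstance, hF1, hG, ?_⟩
  intro ε hε X Y _ _ _ _ _ _ X₀ Y₀ T hT1 hT i j hij
  obtain ⟨i', j', h1, h2, h3, h4, h5⟩ := hG ε hε X Y X₀ Y₀ T hT1 hT i j hij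
  refine ⟨i', j', h1, h2, h3, h4, ?_⟩
  rw [h5, sub_self, norm_zero]
  exact hε
end

section
/- Let Ω: U→V be a nonexpansive linear operator between Banach spaces with the Gurarii property. Then the domain U satisfies condition (g). -/
/-- Every seminorm comes from a linear surjection onto a normed space. -/
theorem exists_normed_quotient (X : Type) [AddCommGroup X] [Module ℝ X] (p : Seminorm ℝ X) :
    ∃ (Y : Type) (_ : NormedAddCommGroup Y) (_ : NormedSpace ℝ Y) (T : X →ₗ[ℝ] Y),
      Function.Surjective T ∧ ∀ x, ‖T x‖ = p x := by
  letI i1 : SeminormedAddCommGroup X := p.toAddGroupSeminorm.toSeminormedAddCommGroup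
  letI i2 : NormedSpace ℝ X := { (inferInstance : Module ℝ X) with
    norm_smul_le := fun a b => (map_smul_eq_mul p a b).le }
  refine ⟨SeparationQuotient X, inferInstance, inferInstance,
    (SeparationQuotient.mkCLM ℝ X).toLinearMap, SeparationQuotient.surjective_mk, fun x => ?_⟩
  exact SeparationQuotient.norm_mk x

/-- The pushout seminorm extending `‖g ·‖` from `X₀` to `X`, dominated by the norm. -/
theorem exists_seminorm_extension {X V : Type*} [NormedAddCommGroup X] [NormedSpace ℝ X]
    [NormedAddCommGroup V] [NormedSpace ℝ V] (X₀ : Submodule ℝ X) (g : X₀ →ₗ[ℝ] V)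
    (hg : ∀ x, ‖g x‖ ≤ ‖x‖) :
    ∃ p : Seminorm ℝ X, (∀ x, p x ≤ ‖x‖) ∧ ∀ x : X₀, p x = ‖g x‖ := by
  have hb : ∀ x : X, BddBelow (Set.range fun z : X₀ => ‖x - z‖ + ‖g z‖) := fun x =>
    ⟨0, by rintro _ ⟨z, rfl⟩; positivity⟩
  let P : X → ℝ := fun x => ⨅ z : X₀, (‖x - z‖ + ‖g z‖)
  have hle : ∀ x (z : X₀), P x ≤ ‖x - z‖ + ‖g z‖ := fun x z => ciInf_le (hb x) z
  have h0 : P 0 = 0 := by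
    apply le_antisymm
    · simpa using hle 0 0
    · exact le_ciInf fun z => by positivity
  refine ⟨Seminorm.ofSMulLE P h0 ?_ ?_, ?_, ?_⟩
  · intro x y
    refine le_ciInf_add_ciInf fun z w => ?_
    refine (hle (x + y) (z + w)).trans ?_
    have h1 : ‖x + y - ((z + w : X₀) : X)‖ ≤ ‖x - z‖ + ‖y - w‖ := by
      have : x + y - ((z + w : X₀) : X) = (x - z) + (y - w) := by push_cast; abel
      rw [this]; exact norm_add_le _ _
    have h2 : ‖g (z + w)‖ ≤ ‖g z‖ + ‖g w‖ := by rw [map_add]; exact norm_add_le _ _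
    linarith
  · intro r x
    show P (r • x) ≤ ‖r‖ * ⨅ z : X₀, (‖x - z‖ + ‖g z‖)
    rw [Real.mul_iInf_of_nonneg (norm_nonneg r)]
    refine le_ciInf fun z => (hle (r • x) (r • z)).trans ?_
    rw [map_smul, norm_smul, Submodule.coe_smul, ← smul_sub, norm_smul, mul_add]
  · intro x
    show P x ≤ _
    simpa using hle x 0
  · intro x
    show P x = _
    apply le_antisymm
    · simpa using hle x x
    · refine le_ciInf fun z => ?_
      have h1 : ‖g (x - z)‖ ≤ ‖(x : X) - z‖ := hg (x - z)
      have h2 : ‖g x‖ ≤ ‖g (x - z)‖ + ‖g z‖ := by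
        have := norm_add_le (g (x - z)) (g z)
        rwa [← map_add, sub_add_cancel] at this
      linarith

/-- The domain of an operator with the Gurarii property satisfies condition (g). -/
theorem domain_satisfies_conditionSmallG
    {U V : Type*} [NormedAddCommGroup U] [NormedSpace ℝ U] [CompleteSpace U]
    [NormedAddCommGroup V] [NormedSpace ℝ V] [CompleteSpace V]
    (Ω : U →L[ℝ] V) (hΩ : ‖Ω‖ ≤ 1) (hG : HasGurariiProperty Ω) :
    SatisfiesConditionSmallG U := by
  intro ε hε X _ _ _ X₀ i
  let g : X₀ →ₗ[ℝ] V := Ω.toLinearMap ∘ₗ i.toLinearMap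
  have hg : ∀ x, ‖g x‖ ≤ ‖x‖ := fun x => by
    have := Ω.le_of_opNorm_le hΩ (i x)
    rwa [one_mul, i.norm_map] at this
  obtain ⟨p, hp1, hp2⟩ := exists_seminorm_extension X₀ g hg
  obtain ⟨Y, _, _, T, hTs, hTn⟩ := exists_normed_quotient X p
  haveI : FiniteDimensional ℝ Y := Module.Finite.of_surjective T hTs
  let T' : X →L[ℝ] Y := T.mkContinuous 1 fun x => by rw [hTn, one_mul]; exact hp1 x
  have hT' : ‖T'‖ ≤ 1 := T.mkContinuous_norm_le zero_le_one _
  let Y₀ : Submodule ℝ Y := X₀.map T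
  have hmem : ∀ x ∈ X₀, T x ∈ Y₀ := fun x hx => Submodule.mem_map_of_mem hx
  let ψ : X₀ →ₗ[ℝ] Y₀ := T.restrict hmem
  have hψn : ∀ x, ‖ψ x‖ = ‖g x‖ := fun x => by
    rw [← hp2, ← hTn]; rfl
  have hψ : Function.Surjective ψ := by
    rintro ⟨y, x, hx, rfl⟩
    exact ⟨⟨x, hx⟩, rfl⟩
  obtain ⟨s, hs⟩ := ψ.exists_rightInverse_of_surjective (LinearMap.range_eq_top.2 hψ)
  have hs' : ∀ y, ψ (s y) = y := fun y => LinearMap.congr_fun hs y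
  let j : Y₀ →ₗᵢ[ℝ] V := ⟨g ∘ₗ s, fun y => by
    rw [LinearMap.comp_apply, ← hψn, hs']⟩
  obtain ⟨i', j', h1, -, h2, -, -⟩ := hG ε hε X Y X₀ Y₀ T' hT' hmem i j (fun x => by
    show g x = g (s (ψ x))
    rw [← sub_eq_zero, ← map_sub, ← norm_eq_zero, ← hψn, map_sub, hs', sub_self, norm_zero])
  exact ⟨i', h1, h2.le⟩
end

section
/- Let Ω: U→V be a nonexpansive linear operator between Banach spaces with the Gurarii property, let ε>0, let T: X₀→Y₀ and R: X₁→Y₁ be nonexpansive linear operators between finite-dimensional Banach spaces, let f = (f₀,f₁) be an ε-embedding of operators from T into Ω, and let j = (j₀,j₁) be an embedding of operators from T into R. Then for every δ>0 there exists a δ-embedding of operators g = (g₀,g₁) from R into Ω such that the composition (g₀∘j₀, g₁∘j₁) is (2ε+δ)-close to (f₀,f₁). -/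
/-- `Fin n → ℝ` renormed by a definite seminorm. -/
def RenormedSpace (n : ℕ) (p : Seminorm ℝ (Fin n → ℝ)) (_hp : ∀ x, p x = 0 → x = 0) : Type :=
  Fin n → ℝ

namespace RenormedSpace

variable {n : ℕ} {p : Seminorm ℝ (Fin n → ℝ)} {hp : ∀ x, p x = 0 → x = 0}

noncomputable instance : AddCommGroup (RenormedSpace n p hp) :=
  inferInstanceAs (AddCommGroup (Fin n → ℝ))

noncomputable instance instMod : Module ℝ (RenormedSpace n p hp) :=
  inferInstanceAs (Module ℝ (Fin n → ℝ))

noncomputable instance : NormedAddCommGroup (RenormedSpace n p hp) :=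
  AddGroupNorm.toNormedAddCommGroup
    { toFun := fun x => p x
      map_zero' := map_zero p
      add_le' := fun x y => map_add_le_add p x y
      neg' := fun x => map_neg_eq_map p x
      eq_zero_of_map_eq_zero' := fun x h => hp x h }

noncomputable instance : NormedSpace ℝ (RenormedSpace n p hp) where
  __ := instMod
  norm_smul_le := fun a x => (map_smul_eq_mul p a x).le

/-- The identity. -/
noncomputable def equiv (n : ℕ) (p : Seminorm ℝ (Fin n → ℝ)) (hp : ∀ x, p x = 0 → x = 0) :
    (Fin n → ℝ) ≃ₗ[ℝ] RenormedSpace n p hp where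
  toFun := fun x => x
  invFun := fun x => x
  map_add' := fun _ _ => rfl
  map_smul' := fun _ _ => rfl
  left_inv := fun _ => rfl
  right_inv := fun _ => rfl

theorem norm_equiv (x : Fin n → ℝ) : ‖equiv n p hp x‖ = p x := rfl

instance : FiniteDimensional ℝ (RenormedSpace n p hp) :=
  LinearEquiv.finiteDimensional (equiv n p hp)

end RenormedSpace

/-- Every finite-dimensional space with a definite seminorm has a normed copy in `Type`. -/
theorem exists_normed_copy {E : Type*} [AddCommGroup E] [Module ℝ E] [FiniteDimensional ℝ E]
    (p : Seminorm ℝ E) (hp : ∀ x, p x = 0 → x = 0) :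
    ∃ (X : Type) (_ : NormedAddCommGroup X) (_ : NormedSpace ℝ X) (_ : FiniteDimensional ℝ X)
      (e : E ≃ₗ[ℝ] X), ∀ x, ‖e x‖ = p x := by
  let b := (Module.finBasis ℝ E).equivFun
  let p' : Seminorm ℝ (Fin (Module.finrank ℝ E) → ℝ) := p.comp b.symm.toLinearMap
  have hp' : ∀ x, p' x = 0 → x = 0 := fun x hx => by
    have := hp (b.symm x) hx
    simpa using this
  refine ⟨RenormedSpace _ p' hp', inferInstance, inferInstance, inferInstance,
    b.trans (RenormedSpace.equiv _ p' hp'), fun x => ?_⟩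
  rw [LinearEquiv.trans_apply, RenormedSpace.norm_equiv]
  simp [p']

/-- Given an isometric map from a subspace `A` of `U`, the inverse from its range. -/
theorem exists_inverse_isometry {U X : Type*} [NormedAddCommGroup U] [NormedSpace ℝ U]
    [NormedAddCommGroup X] [NormedSpace ℝ X] (A : Submodule ℝ U)
    (k : A →ₗ[ℝ] X) (hk : ∀ a, ‖k a‖ = ‖a‖) :
    ∃ i : LinearMap.range k →ₗᵢ[ℝ] U, ∀ a : A, i ⟨k a, LinearMap.mem_range_self k a⟩ = a := by
  have hinj : Function.Injective k := by
    rw [← LinearMap.ker_eq_bot, LinearMap.ker_eq_bot']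
    intro a ha
    have := hk a
    rw [ha, norm_zero] at this
    exact norm_eq_zero.mp this.symm
  let e := LinearEquiv.ofInjective k hinj
  have he : ∀ a : A, e.symm ⟨k a, LinearMap.mem_range_self k a⟩ = a := fun a => by
    rw [LinearEquiv.symm_apply_eq]
    rfl
  refine ⟨⟨A.subtype ∘ₗ e.symm.toLinearMap, ?_⟩, ?_⟩
  · rintro ⟨_, a, rfl⟩
    have h2 := hk a
    simp only [LinearMap.comp_apply, LinearEquiv.coe_coe, he]
    exact h2.symm
  · intro a
    change ((e.symm ⟨k a, LinearMap.mem_range_self k a⟩ : A) : U) = a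
    rw [he]

/-- Gurarii property in terms of seminorms, in arbitrary universes. -/
theorem HasGurariiProperty.apply_seminorm {U V : Type*} [NormedAddCommGroup U] [NormedSpace ℝ U]
    [NormedAddCommGroup V] [NormedSpace ℝ V] {Ω : U →L[ℝ] V} (hG : HasGurariiProperty Ω)
    {η : ℝ} (hη : 0 < η) {E F : Type*} [AddCommGroup E] [Module ℝ E] [FiniteDimensional ℝ E]
    [AddCommGroup F] [Module ℝ F] [FiniteDimensional ℝ F]
    (p : Seminorm ℝ E) (hp : ∀ x, p x = 0 → x = 0)
    (q : Seminorm ℝ F) (hq : ∀ x, q x = 0 → x = 0)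
    (Q : E →ₗ[ℝ] F) (hQ : ∀ x, q (Q x) ≤ p x)
    (A : Submodule ℝ U) (B : Submodule ℝ V) (hAB : ∀ a ∈ A, Ω a ∈ B)
    (k : A →ₗ[ℝ] E) (hk : ∀ a, p (k a) = ‖a‖) (l : B →ₗ[ℝ] F) (hl : ∀ b, q (l b) = ‖b‖)
    (hkl : ∀ a : A, Q (k a) = l ⟨Ω a, hAB a a.2⟩) :
    ∃ (i' : E →ₗ[ℝ] U) (j' : F →ₗ[ℝ] V),
      (∀ x, (1 + η)⁻¹ * p x ≤ ‖i' x‖ ∧ ‖i' x‖ ≤ p x) ∧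
      (∀ x, (1 + η)⁻¹ * q x ≤ ‖j' x‖ ∧ ‖j' x‖ ≤ q x) ∧
      (∀ a : A, ‖i' (k a) - a‖ ≤ η * ‖a‖) ∧
      (∀ b : B, ‖j' (l b) - b‖ ≤ η * ‖b‖) ∧
      (∀ x, ‖Ω (i' x) - j' (Q x)‖ ≤ η * p x) := by
  obtain ⟨X, _, _, _, e, he⟩ := exists_normed_copy p hp
  obtain ⟨Y, _, _, _, d, hd⟩ := exists_normed_copy q hq
  let k' : A →ₗ[ℝ] X := e.toLinearMap ∘ₗ k
  let l' : B →ₗ[ℝ] Y := d.toLinearMap ∘ₗ l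
  have hk' : ∀ a, ‖k' a‖ = ‖a‖ := fun a => (he _).trans (hk a)
  have hl' : ∀ b, ‖l' b‖ = ‖b‖ := fun b => (hd _).trans (hl b)
  obtain ⟨i, hi⟩ := exists_inverse_isometry A k' hk'
  obtain ⟨j, hj⟩ := exists_inverse_isometry B l' hl'
  let T : X →L[ℝ] Y := LinearMap.toContinuousLinearMap (d.toLinearMap ∘ₗ Q ∘ₗ e.symm.toLinearMap)
  have hTe : ∀ x, T (e x) = d (Q x) := fun x => by simp [T]
  have hT : ‖T‖ ≤ 1 := by
    refine T.opNorm_le_bound zero_le_one fun x => ?_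
    obtain ⟨x, rfl⟩ := e.surjective x
    rw [hTe, hd, he, one_mul]
    exact hQ x
  have hTk : ∀ a : A, T (k' a) = l' ⟨Ω a, hAB a a.2⟩ := fun a => by
    change T (e (k a)) = d (l _)
    rw [hTe, hkl]
  have hTr : ∀ x ∈ LinearMap.range k', T x ∈ LinearMap.range l' := by
    rintro _ ⟨a, rfl⟩
    exact ⟨_, (hTk a).symm⟩
  obtain ⟨i', j', h1, h2, h3, h4, h5⟩ := hG η hη X Y (LinearMap.range k') (LinearMap.range l') T hT
    hTr i j (by
      rintro ⟨_, a, rfl⟩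
      rw [hi]
      have : (⟨T (k' a), hTr _ (LinearMap.mem_range_self k' a)⟩ : LinearMap.range l')
          = ⟨l' ⟨Ω a, hAB a a.2⟩, LinearMap.mem_range_self l' _⟩ := Subtype.ext (hTk a)
      exact ((congrArg j this).trans (hj _)).symm)
  refine ⟨i'.toLinearMap ∘ₗ e.toLinearMap, j'.toLinearMap ∘ₗ d.toLinearMap, ?_, ?_, ?_, ?_, ?_⟩
  · intro x
    rw [← he]
    exact h1 (e x)
  · intro x
    rw [← hd]
    exact h2 (d x)
  · intro a
    have := ContinuousLinearMap.le_of_opNorm_le _ h3.le ⟨k' a, LinearMap.mem_range_self k' a⟩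
    have h6 : ‖(⟨k' a, LinearMap.mem_range_self k' a⟩ : LinearMap.range k')‖ = ‖a‖ := hk' a
    rw [h6] at this
    change ‖i' (k' a) - i _‖ ≤ _ at this
    rw [hi] at this
    exact this
  · intro a
    have := ContinuousLinearMap.le_of_opNorm_le _ h4.le ⟨l' a, LinearMap.mem_range_self l' a⟩
    have h6 : ‖(⟨l' a, LinearMap.mem_range_self l' a⟩ : LinearMap.range l')‖ = ‖a‖ := hl' a
    rw [h6] at this
    change ‖j' (l' a) - j _‖ ≤ _ at this
    rw [hj] at this
    exact this
  · intro x
    have := ContinuousLinearMap.le_of_opNorm_le _ h5.le (e x)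
    rw [he] at this
    change ‖Ω (i' (e x)) - j' (T (e x))‖ ≤ _ at this
    rw [hTe] at this
    exact this

section Pushout

variable {A B W : Type*} [NormedAddCommGroup A] [NormedSpace ℝ A] [NormedAddCommGroup B]
  [NormedSpace ℝ B] [NormedAddCommGroup W] [NormedSpace ℝ W]

/-- The function whose infimum is the pushout seminorm. -/
def pushAux (j : W →L[ℝ] A) (f : W →L[ℝ] B) (c : ℝ) (x : A × B) (w : W) : ℝ :=
  ‖x.1 - j w‖ + ‖x.2 + f w‖ + c * ‖w‖

theorem pushAux_nonneg (j : W →L[ℝ] A) (f : W →L[ℝ] B) {c : ℝ} (hc : 0 ≤ c) (x : A × B) (w : W) :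
    0 ≤ pushAux j f c x w := by
  unfold pushAux
  positivity

theorem pushAux_bdd (j : W →L[ℝ] A) (f : W →L[ℝ] B) {c : ℝ} (hc : 0 ≤ c) (x : A × B) :
    BddBelow (Set.range (pushAux j f c x)) :=
  ⟨0, by rintro _ ⟨w, rfl⟩; exact pushAux_nonneg j f hc x w⟩

/-- The pushout seminorm. -/
noncomputable def pushSeminorm (j : W →L[ℝ] A) (f : W →L[ℝ] B) (c : ℝ) (hc : 0 ≤ c) :
    Seminorm ℝ (A × B) :=
  Seminorm.ofSMulLE (fun x => ⨅ w, pushAux j f c x w)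
    (le_antisymm
      ((ciInf_le (pushAux_bdd j f hc 0) 0).trans (by simp [pushAux]))
      (le_ciInf fun w => pushAux_nonneg j f hc 0 w))
    (fun x y => by
      refine le_ciInf_add_ciInf fun w w' => ?_
      refine (ciInf_le (pushAux_bdd j f hc (x + y)) (w + w')).trans ?_
      have h1 := norm_add_le (x.1 - j w) (y.1 - j w')
      have h2 := norm_add_le (x.2 + f w) (y.2 + f w')
      have h3 := mul_le_mul_of_nonneg_left (norm_add_le w w') hc
      have e1 : (x + y).1 - j (w + w') = x.1 - j w + (y.1 - j w') := by
        rw [map_add, Prod.fst_add]; abel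
      have e2 : (x + y).2 + f (w + w') = x.2 + f w + (y.2 + f w') := by
        rw [map_add, Prod.snd_add]; abel
      unfold pushAux
      rw [e1, e2]
      linarith)
    (fun r x => by
      rw [Real.mul_iInf_of_nonneg (norm_nonneg r)]
      refine le_ciInf fun w => (ciInf_le (pushAux_bdd j f hc (r • x)) (r • w)).trans ?_
      unfold pushAux
      rw [Prod.smul_fst, Prod.smul_snd, map_smul, map_smul, ← smul_sub, ← smul_add, norm_smul,
        norm_smul, norm_smul]
      apply le_of_eq
      ring)

theorem pushSeminorm_le (j : W →L[ℝ] A) (f : W →L[ℝ] B) {c : ℝ} (hc : 0 ≤ c) (x : A × B) (w : W) :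
    pushSeminorm j f c hc x ≤ ‖x.1 - j w‖ + ‖x.2 + f w‖ + c * ‖w‖ :=
  ciInf_le (pushAux_bdd j f hc x) w

theorem le_pushSeminorm (j : W →L[ℝ] A) (f : W →L[ℝ] B) {c : ℝ} (hc : 0 ≤ c) (x : A × B) {t : ℝ}
    (h : ∀ w, t ≤ ‖x.1 - j w‖ + ‖x.2 + f w‖ + c * ‖w‖) : t ≤ pushSeminorm j f c hc x :=
  le_ciInf h

variable (j : W →ₗᵢ[ℝ] A) (f : W →L[ℝ] B) {ε c : ℝ}

theorem push_inl (hε : 0 < ε) (hf : IsEpsIsometry ε f) (hc : 0 ≤ c) (hεc : ε ≤ c) (a : A) :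
    pushSeminorm j.toContinuousLinearMap f c hc (a, 0) = ‖a‖ := by
  apply le_antisymm
  · simpa using pushSeminorm_le j.toContinuousLinearMap f hc (a, 0) 0
  · refine le_pushSeminorm _ _ _ _ fun w => ?_
    have h1 : ‖a‖ ≤ ‖a - j w‖ + ‖w‖ := by
      have := norm_add_le (a - j w) (j w)
      rwa [sub_add_cancel, j.norm_map] at this
    have h2 := (hf w).1
    have h3 : 1 ≤ (1 + ε)⁻¹ + c := by
      have : 1 - ε ≤ (1 + ε)⁻¹ := by
        rw [← one_div, le_div_iff₀ (by linarith)]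
        nlinarith
      linarith
    have h4 := mul_le_mul_of_nonneg_right h3 (norm_nonneg w)
    simp only [zero_add, LinearIsometry.coe_toContinuousLinearMap]
    linarith

theorem push_inr (hf : IsEpsIsometry ε f) (hc : 0 ≤ c) (b : B) :
    pushSeminorm j.toContinuousLinearMap f c hc (0, b) = ‖b‖ := by
  apply le_antisymm
  · simpa using pushSeminorm_le j.toContinuousLinearMap f hc (0, b) 0
  · refine le_pushSeminorm _ _ _ _ fun w => ?_
    have h1 : ‖b‖ ≤ ‖b + f w‖ + ‖f w‖ := by
      have := norm_sub_le (b + f w) (f w)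
      rwa [add_sub_cancel_right] at this
    have h2 := (hf w).2
    have h4 := mul_nonneg hc (norm_nonneg w)
    simp only [zero_sub, norm_neg, LinearIsometry.coe_toContinuousLinearMap, j.norm_map]
    linarith

theorem push_definite (hf : IsEpsIsometry ε f) (hc : 0 < c) (x : A × B)
    (hx : pushSeminorm j.toContinuousLinearMap f c hc.le x = 0) : x = 0 := by
  have key : c * (‖x.1‖ + ‖x.2‖) / (c + 2) ≤
      pushSeminorm j.toContinuousLinearMap f c hc.le x := by
    refine le_pushSeminorm _ _ _ _ fun w => ?_
    have h1 : ‖x.1‖ ≤ ‖x.1 - j w‖ + ‖w‖ := by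
      have := norm_add_le (x.1 - j w) (j w)
      rwa [sub_add_cancel, j.norm_map] at this
    have h2 : ‖x.2‖ ≤ ‖x.2 + f w‖ + ‖w‖ := by
      have := norm_sub_le (x.2 + f w) (f w)
      rw [add_sub_cancel_right] at this
      linarith [(hf w).2]
    rw [div_le_iff₀ (by linarith)]
    simp only [LinearIsometry.coe_toContinuousLinearMap]
    have h3 := mul_le_mul_of_nonneg_left (add_le_add h1 h2) hc.le
    have h4 := mul_nonneg (mul_nonneg hc.le hc.le) (norm_nonneg w)
    nlinarith [norm_nonneg (x.1 - j w), norm_nonneg (x.2 + f w)]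
  rw [hx, div_le_iff₀ (by linarith), zero_mul] at key
  have h5 := nonpos_of_mul_nonpos_right key hc
  have h6 := norm_nonneg x.1
  have h7 := norm_nonneg x.2
  exact Prod.ext (norm_eq_zero.mp (by linarith)) (norm_eq_zero.mp (by linarith))

end Pushout

/-- Lemma on extending almost embeddings of operators: if `f = (f₀, f₁)` is an
`ε`-embedding of the operator `T` into `Ω` and `j = (j₀, j₁)` is an embedding of `T`
into `R` (all between finite-dimensional spaces), then for every `δ > 0` there is a
`δ`-embedding `g = (g₀, g₁)` of `R` into `Ω` whose composition with `j` is
`(2ε + δ)`-close to `f`. -/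
theorem exists_almost_embedding_factoring
    {U V : Type*} [NormedAddCommGroup U] [NormedSpace ℝ U] [CompleteSpace U]
    [NormedAddCommGroup V] [NormedSpace ℝ V] [CompleteSpace V]
    (Ω : U →L[ℝ] V) (hΩ : ‖Ω‖ ≤ 1) (hG : HasGurariiProperty Ω)
    (ε : ℝ) (hε : 0 < ε)
    {X₀ Y₀ X₁ Y₁ : Type*}
    [NormedAddCommGroup X₀] [NormedSpace ℝ X₀] [FiniteDimensional ℝ X₀]
    [NormedAddCommGroup Y₀] [NormedSpace ℝ Y₀] [FiniteDimensional ℝ Y₀]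
    [NormedAddCommGroup X₁] [NormedSpace ℝ X₁] [FiniteDimensional ℝ X₁]
    [NormedAddCommGroup Y₁] [NormedSpace ℝ Y₁] [FiniteDimensional ℝ Y₁]
    (T : X₀ →L[ℝ] Y₀) (hT : ‖T‖ ≤ 1) (R : X₁ →L[ℝ] Y₁) (hR : ‖R‖ ≤ 1)
    (f₀ : X₀ →L[ℝ] U) (f₁ : Y₀ →L[ℝ] V)
    (hf₀ : IsEpsIsometry ε f₀) (hf₁ : IsEpsIsometry ε f₁)
    (hf : ‖Ω.comp f₀ - f₁.comp T‖ ≤ ε)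
    (j₀ : X₀ →ₗᵢ[ℝ] X₁) (j₁ : Y₀ →ₗᵢ[ℝ] Y₁)
    (hj : ∀ x : X₀, R (j₀ x) = j₁ (T x))
    (δ : ℝ) (hδ : 0 < δ) :
    ∃ (g₀ : X₁ →L[ℝ] U) (g₁ : Y₁ →L[ℝ] V),
      IsEpsIsometry δ g₀ ∧ IsEpsIsometry δ g₁ ∧
      ‖Ω.comp g₀ - g₁.comp R‖ ≤ δ ∧
      ‖g₀.comp j₀.toContinuousLinearMap - f₀‖ ≤ 2 * ε + δ ∧
      ‖g₁.comp j₁.toContinuousLinearMap - f₁‖ ≤ 2 * ε + δ := by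
  have h2ε : 0 < 2 * ε := by linarith
  let A : Submodule ℝ U := LinearMap.range f₀.toLinearMap
  let B : Submodule ℝ V := LinearMap.range f₁.toLinearMap ⊔ A.map Ω.toLinearMap
  have hAB : ∀ a ∈ A, Ω a ∈ B := fun a ha =>
    Submodule.mem_sup_right (Submodule.mem_map_of_mem (f := Ω.toLinearMap) ha)
  have hfA : ∀ x, f₀ x ∈ A := fun x => LinearMap.mem_range_self f₀.toLinearMap x
  have hfB : ∀ x, f₁ x ∈ B := fun x =>
    Submodule.mem_sup_left (LinearMap.mem_range_self f₁.toLinearMap x)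
  let P := pushSeminorm j₀.toContinuousLinearMap f₀ (2 * ε) h2ε.le
  let S := pushSeminorm j₁.toContinuousLinearMap f₁ ε hε.le
  let m : X₁ × A →ₗ[ℝ] X₁ × U := LinearMap.id.prodMap A.subtype
  let m' : Y₁ × B →ₗ[ℝ] Y₁ × V := LinearMap.id.prodMap B.subtype
  let Ω' : A →ₗ[ℝ] B := Ω.toLinearMap.restrict hAB
  have hPS : ∀ x u, S (R x, Ω u) ≤ P (x, u) := by
    intro x u
    refine le_pushSeminorm _ _ _ _ fun w => ?_
    refine (pushSeminorm_le _ _ _ _ (T w)).trans ?_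
    simp only [LinearIsometry.coe_toContinuousLinearMap]
    have e1 : R x - j₁ (T w) = R (x - j₀ w) := by rw [map_sub, hj]
    have e2 : Ω u + f₁ (T w) = Ω (u + f₀ w) - (Ω.comp f₀ - f₁.comp T) w := by
      simp only [map_add, sub_apply, ContinuousLinearMap.comp_apply]
      abel
    have h1 := R.le_of_opNorm_le hR (x - j₀ w)
    have h2 := Ω.le_of_opNorm_le hΩ (u + f₀ w)
    have h3 := ContinuousLinearMap.le_of_opNorm_le _ hf w
    have h4 := norm_sub_le (Ω (u + f₀ w)) ((Ω.comp f₀ - f₁.comp T) w)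
    have h5 := mul_le_mul_of_nonneg_left (T.le_of_opNorm_le hT w) hε.le
    rw [e1, e2]
    linarith
  obtain ⟨i', j', h1, h2, h3, h4, h5⟩ := hG.apply_seminorm hδ (P.comp m)
    (fun x hx => by
      have h := push_definite j₀ f₀ hf₀ h2ε (m x) hx
      exact Prod.ext (show x.1 = 0 from (Prod.ext_iff.mp h).1)
        (Subtype.ext (Prod.ext_iff.mp h).2))
    (S.comp m')
    (fun x hx => by
      have h := push_definite j₁ f₁ hf₁ hε (m' x) hx
      exact Prod.ext (show x.1 = 0 from (Prod.ext_iff.mp h).1)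
        (Subtype.ext (Prod.ext_iff.mp h).2))
    (R.toLinearMap.prodMap Ω') (fun x => hPS x.1 x.2) A B hAB
    (LinearMap.inr ℝ X₁ A) (fun a => push_inr j₀ f₀ hf₀ h2ε.le (a : U))
    (LinearMap.inr ℝ Y₁ B) (fun b => push_inr j₁ f₁ hf₁ hε.le (b : V))
    (fun a => Prod.ext (map_zero R) rfl)
  have hPl : ∀ x : X₁, P.comp m (x, 0) = ‖x‖ := fun x =>
    push_inl j₀ f₀ hε hf₀ h2ε.le (by linarith) x
  have hSl : ∀ y : Y₁, S.comp m' (y, 0) = ‖y‖ := fun y =>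
    push_inl j₁ f₁ hε hf₁ hε.le le_rfl y
  refine ⟨LinearMap.toContinuousLinearMap (i' ∘ₗ LinearMap.inl ℝ X₁ A),
    LinearMap.toContinuousLinearMap (j' ∘ₗ LinearMap.inl ℝ Y₁ B), ?_, ?_, ?_, ?_, ?_⟩
  · intro x
    have := h1 (x, 0)
    rwa [hPl] at this
  · intro x
    have := h2 (x, 0)
    rwa [hSl] at this
  · refine ContinuousLinearMap.opNorm_le_bound _ hδ.le fun x => ?_
    have := h5 (x, 0)
    rw [hPl] at this
    have e : (R.toLinearMap.prodMap Ω') (x, (0 : A)) = (R x, 0) := Prod.ext rfl (map_zero Ω')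
    rw [e] at this
    exact this
  · refine ContinuousLinearMap.opNorm_le_bound _ (by linarith) fun x => ?_
    change ‖i' (j₀ x, 0) - f₀ x‖ ≤ _
    let a : A := ⟨f₀ x, hfA x⟩
    have e : i' (j₀ x, 0) - f₀ x = i' (j₀ x, -a) + (i' (0, a) - f₀ x) := by
      rw [← add_sub_assoc, ← map_add]
      simp
    have g1 : ‖i' (j₀ x, -a)‖ ≤ 2 * ε * ‖x‖ := by
      refine (h1 _).2.trans ?_
      have := pushSeminorm_le j₀.toContinuousLinearMap f₀ h2ε.le (j₀ x, -f₀ x) x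
      refine le_trans (le_of_eq rfl) (this.trans ?_)
      simp
    have g2 : ‖i' (0, a) - f₀ x‖ ≤ δ * ‖f₀ x‖ := h3 a
    have g3 := mul_le_mul_of_nonneg_left (hf₀ x).2 hδ.le
    rw [e]
    refine (norm_add_le _ _).trans ?_
    linarith
  · refine ContinuousLinearMap.opNorm_le_bound _ (by linarith) fun x => ?_
    change ‖j' (j₁ x, 0) - f₁ x‖ ≤ _
    let a : B := ⟨f₁ x, hfB x⟩
    have e : j' (j₁ x, 0) - f₁ x = j' (j₁ x, -a) + (j' (0, a) - f₁ x) := by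
      rw [← add_sub_assoc, ← map_add]
      simp
    have g1 : ‖j' (j₁ x, -a)‖ ≤ ε * ‖x‖ := by
      refine (h2 _).2.trans ?_
      have := pushSeminorm_le j₁.toContinuousLinearMap f₁ hε.le (j₁ x, -f₁ x) x
      refine le_trans (le_of_eq rfl) (this.trans ?_)
      simp
    have g2 : ‖j' (0, a) - f₁ x‖ ≤ δ * ‖f₁ x‖ := h4 a
    have g3 := mul_le_mul_of_nonneg_left (hf₁ x).2 hδ.le
    have g4 := mul_nonneg hε.le (norm_nonneg x)
    rw [e]
    refine (norm_add_le _ _).trans ?_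
    linarith
end
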